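/- For any N×N complex matrices A and B and any partitions λ, μ with at most N parts, ∫_{M_N(ℂ)} s_λ(XA) s_μ(X† B) dμ_G(X) = δ_{λ,μ} · N^{−|λ|} · s_λ(AB) / s_λ(p_∞), i.e. the Gaussian integral vanishes unless λ = μ, in which case it equals N^{−|λ|} s_λ(AB)/s_λ(p_∞). -/

import Mathlib

open scoped BigOperators Classical
open MeasureTheory Matrix

noncomputable section

/-- Complete homogeneous symmetric functions of the eigenvalues of `X`, defined through
Newton's identities from the power sums `p_m = Tr(X^m)`. -/
def hMat {N : ℕ} (X : Matrix (Fin N) (Fin N) ℂ) : ℕ → ℂ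
  | 0 => 1
  | (k+1) => ((k : ℂ) + 1)⁻¹ *
      ∑ m ∈ Finset.range (k+1), (X ^ (m+1)).trace * hMat X (k - m)
  termination_by k => k
  decreasing_by exact Nat.lt_succ_of_le (Nat.sub_le _ _)

def hMatZ {N : ℕ} (X : Matrix (Fin N) (Fin N) ℂ) (k : ℤ) : ℂ :=
  if k < 0 then 0 else hMat X k.toNat

/-- The Schur polynomial `s_λ(X)` of an `N×N` complex matrix `X`, evaluated at the
eigenvalues of `X`, via the Jacobi-Trudi formula `s_λ = det(h_{λ_i - i + j})`.
Here `l : Fin N → ℕ` lists the (at most `N`) parts of the partition `λ`. -/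
def schur {N : ℕ} (l : Fin N → ℕ) (X : Matrix (Fin N) (Fin N) ℂ) : ℂ :=
  (Matrix.of fun i j : Fin N => hMatZ X ((l i : ℤ) - (i : ℤ) + (j : ℤ))).det

/-- Partitions with at most `N` parts (weakly decreasing functions `Fin N → ℕ`). -/
def PartitionN (N : ℕ) := {l : Fin N → ℕ // Antitone l}

/-- `1/k!` for `k : ℤ`, zero for negative `k`. -/
def factInvZ (k : ℤ) : ℂ := if k < 0 then 0 else ((Nat.factorial k.toNat : ℂ))⁻¹

/-- The specialization `s_λ(p_∞) = dim λ / |λ|!` of the Schur function at the power sums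
`p_1 = 1`, `p_k = 0` for `k ≥ 2`, via Jacobi-Trudi (`h_k(p_∞) = 1/k!`). -/
def schurPInf {N : ℕ} (l : Fin N → ℕ) : ℂ :=
  (Matrix.of fun i j : Fin N => factInvZ ((l i : ℤ) - (i : ℤ) + (j : ℤ))).det

/-- The weight `|λ| = Σ λ_i` of a partition. -/
def wt {N : ℕ} (l : Fin N → ℕ) : ℕ := ∑ i, l i

instance {N : ℕ} : MeasureSpace (Matrix (Fin N) (Fin N) ℂ) :=
  inferInstanceAs (MeasureSpace (Fin N → Fin N → ℂ))

/-- The Gaussian probability measure on `N×N` complex matrices, with density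
`(N/π)^{N²} · exp(-N Tr(X X†))` with respect to Lebesgue measure on the entries. -/
def gaussianMatrix (N : ℕ) : Measure (Matrix (Fin N) (Fin N) ℂ) :=
  volume.withDensity fun X =>
    ENNReal.ofReal (((N : ℝ) / Real.pi) ^ (N ^ 2) *
      Real.exp (-(N : ℝ) * ∑ i, ∑ j, Complex.normSq (X i j)))

section

theorem Derivation.leibniz_det {R A n : Type*} [CommRing R] [CommRing A] [Algebra R A]
    [Fintype n] [DecidableEq n] (D : Derivation R A A) (M : Matrix n n A) :
    D M.det = (M.adjugate * M.map D).trace := by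
  have hprod : ∀ (s : Finset n) (f : n → A),
      D (∏ i ∈ s, f i) = ∑ i ∈ s, D (f i) * ∏ j ∈ s.erase i, f j := by
    intro s f
    induction s using Finset.induction_on with
    | empty => simp
    | insert a s ha ih =>
      rw [Finset.prod_insert ha, D.leibniz, ih, Finset.sum_insert ha, Finset.erase_insert ha,
        smul_eq_mul, smul_eq_mul, Finset.mul_sum, add_comm, mul_comm]
      congr 1
      refine Finset.sum_congr rfl fun i hi => ?_
      have hne : a ≠ i := fun h => ha (h ▸ hi)
      rw [Finset.erase_insert_of_ne hne, Finset.prod_insert (by simp [ha])]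
      ring
  have h1 : (M.adjugate * M.map D).trace = ∑ i, (M.updateRow i fun j => D (M i j)).det := by
    rw [Matrix.trace_mul_comm]
    refine Finset.sum_congr rfl fun i _ => ?_
    rw [← Matrix.cramer_transpose_apply, Matrix.cramer_eq_adjugate_mulVec, Matrix.diag_apply,
      Matrix.mul_apply, Matrix.mulVec, dotProduct]
    refine Finset.sum_congr rfl fun j _ => ?_
    rw [← Matrix.adjugate_transpose, Matrix.transpose_apply, Matrix.map_apply, mul_comm]
  rw [h1]
  simp_rw [Matrix.det_apply', map_sum]
  rw [Finset.sum_comm]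
  refine Finset.sum_congr rfl fun σ _ => ?_
  rw [D.leibniz, D.map_intCast, smul_zero, add_zero, smul_eq_mul, hprod, Finset.mul_sum]
  refine ((Equiv.sum_comp σ _).symm.trans (Finset.sum_congr rfl fun i _ => ?_)).symm
  rw [← Finset.mul_prod_erase Finset.univ _ (Finset.mem_univ i), Matrix.updateRow_self]
  congr 2
  refine Finset.prod_congr rfl fun j hj => ?_
  rw [Matrix.updateRow_ne fun h => (Finset.ne_of_mem_erase hj) (σ.injective h)]

variable {N : ℕ}

theorem hMat_zero (X : Matrix (Fin N) (Fin N) ℂ) : hMat X 0 = 1 := by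
  rw [hMat]

theorem succ_mul_hMat (X : Matrix (Fin N) (Fin N) ℂ) (k : ℕ) :
    ((k : ℂ) + 1) * hMat X (k + 1) =
      ∑ m ∈ Finset.range (k + 1), (X ^ (m + 1)).trace * hMat X (k - m) := by
  rw [hMat, ← mul_assoc, mul_inv_cancel₀ (Nat.cast_add_one_ne_zero k), one_mul]

open PowerSeries in
theorem det_one_sub_X_smul_mul_mk_hMat (M : Matrix (Fin N) (Fin N) ℂ) :
    (1 - (PowerSeries.X : ℂ⟦X⟧) • M.map (PowerSeries.C)).det * PowerSeries.mk (hMat M) = 1 := by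
  set A : Matrix (Fin N) (Fin N) ℂ⟦X⟧ := 1 - (PowerSeries.X : ℂ⟦X⟧) • M.map (PowerSeries.C) with hA
  set G : Matrix (Fin N) (Fin N) ℂ⟦X⟧ :=
    Matrix.of fun i j => PowerSeries.mk fun k => (M ^ k) i j with hG
  have hMG : ∀ i j, (M.map (PowerSeries.C) * G) i j =
      PowerSeries.mk fun k => (M ^ (k + 1)) i j := by
    intro i j
    ext k
    simp [hG, Matrix.mul_apply, pow_succ']
  have hAG : A * G = 1 := by
    ext i j k
    rw [hA, Matrix.sub_mul, Matrix.one_mul, Matrix.smul_mul, Matrix.sub_apply, Matrix.smul_apply,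
      hMG, smul_eq_mul]
    cases k with
    | zero => by_cases h : i = j <;> simp [hG, h, Matrix.one_apply]
    | succ k =>
      rw [map_sub, PowerSeries.coeff_succ_X_mul]
      by_cases h : i = j <;> simp [hG, h, Matrix.one_apply, PowerSeries.coeff_one]
  have hadj : A.adjugate = A.det • G := by
    calc A.adjugate = A.adjugate * (A * G) := by rw [hAG, Matrix.mul_one]
      _ = _ := by rw [← Matrix.mul_assoc, Matrix.adjugate_mul, Matrix.smul_mul, Matrix.one_mul]
  have hAd : A.map (PowerSeries.derivative ℂ) = - M.map (PowerSeries.C) := by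
    ext i j : 2
    by_cases h : i = j <;> simp [hA, h]
  set P : ℂ⟦X⟧ := PowerSeries.mk fun k => (M ^ (k + 1)).trace with hP
  have hE : PowerSeries.derivative ℂ A.det = - (A.det * P) := by
    rw [Derivation.leibniz_det, hadj, hAd, Matrix.mul_neg, Matrix.smul_mul, Matrix.trace_neg,
      Matrix.trace_smul, Matrix.trace_mul_comm, smul_eq_mul]
    congr 2
    simp only [Matrix.trace, Matrix.diag_apply, hMG, hP]
    ext k
    simp
  have hH : PowerSeries.derivative ℂ (PowerSeries.mk (hMat M)) = P * PowerSeries.mk (hMat M) := by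
    ext k
    rw [PowerSeries.coeff_derivative, PowerSeries.coeff_mul, PowerSeries.coeff_mk, mul_comm,
      succ_mul_hMat, Finset.Nat.sum_antidiagonal_eq_sum_range_succ_mk]
    simp [hP]
  apply PowerSeries.derivative.ext
  · rw [Derivation.leibniz, hE, hH]
    simp
    ring
  · rw [map_mul, RingHom.map_det]
    have : (PowerSeries.constantCoeff (R := ℂ)).mapMatrix A = 1 := by
      ext i j
      by_cases h : i = j <;> simp [hA, h, Matrix.one_apply]
    rw [this]
    simp [hMat_zero]

theorem hMatZ_natCast (X : Matrix (Fin N) (Fin N) ℂ) (k : ℕ) : hMatZ X k = hMat X k := by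
  simp [hMatZ]

theorem hMatZ_of_neg (X : Matrix (Fin N) (Fin N) ℂ) {k : ℤ} (hk : k < 0) : hMatZ X k = 0 := by
  simp [hMatZ, hk]

theorem det_one_sub_X_smul_eq_charpolyRev (M : Matrix (Fin N) (Fin N) ℂ) :
    (1 - (PowerSeries.X : PowerSeries ℂ) • M.map (PowerSeries.C)).det =
      (M.charpolyRev : PowerSeries ℂ) := by
  rw [Matrix.charpolyRev, ← Polynomial.coeToPowerSeries.ringHom_apply, RingHom.map_det]
  congr 1
  ext i j : 2
  by_cases h : i = j <;> simp [h] <;> ring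

theorem natDegree_charpolyRev_le (M : Matrix (Fin N) (Fin N) ℂ) : M.charpolyRev.natDegree ≤ N := by
  rw [← Matrix.reverse_charpoly]
  refine (Polynomial.reverse_natDegree_le _).trans ?_
  rcases isEmpty_or_nonempty (Fin N) with h | h <;> simp

theorem sum_charpolyRev_coeff_mul_hMatZ (M : Matrix (Fin N) (Fin N) ℂ) {m : ℤ} (hm : 0 < m) :
    ∑ j ∈ Finset.range (N + 1), M.charpolyRev.coeff j * hMatZ M (m - j) = 0 := by
  lift m to ℕ using hm.le
  have h := congrArg (PowerSeries.coeff m) (det_one_sub_X_smul_mul_mk_hMat M)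
  rw [det_one_sub_X_smul_eq_charpolyRev, PowerSeries.coeff_mul, PowerSeries.coeff_one,
    if_neg (by omega), Finset.Nat.sum_antidiagonal_eq_sum_range_succ_mk] at h
  rw [← h]
  have e1 : ∀ (a : ℕ) (f : ℕ → ℂ), (∀ j, a < j → j ≤ N + m → f j = 0) → a ≤ N + m →
      ∑ j ∈ Finset.range (a + 1), f j = ∑ j ∈ Finset.range (N + m + 1), f j := by
    intro a f hf ha
    refine Finset.sum_subset (by intro x; simp; omega) fun x hx hx' => hf x ?_ ?_ <;>
      simp at hx hx' <;> omega
  rw [e1 N _ _ (by omega), Nat.succ_eq_add_one]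
  · rw [← Finset.sum_subset (s₁ := Finset.range (m + 1)) (by intro x; simp; omega)]
    · refine Finset.sum_congr rfl fun j hj => ?_
      simp at hj
      rw [← Nat.cast_sub (by omega), hMatZ_natCast]
      simp
    · intro x hx hx'
      simp at hx hx'
      rw [hMatZ_of_neg _ (by omega), mul_zero]
  · intro j hj _
    rw [Polynomial.coeff_eq_zero_of_natDegree_lt ((natDegree_charpolyRev_le M).trans_lt hj),
      zero_mul]

/-- The companion matrix of the recurrence satisfied by the complete homogeneous functions. -/
def shiftMat (M : Matrix (Fin N) (Fin N) ℂ) : Matrix (Fin N) (Fin N) ℂ :=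
  Matrix.of fun i j => (if (i : ℕ) = j + 1 then 1 else 0) +
    if (j : ℕ) + 1 = N then -M.charpolyRev.coeff (N - i) else 0

theorem sum_hMatZ_mul_shiftMat (M : Matrix (Fin N) (Fin N) ℂ) {a : ℤ} (ha : 0 < a + N)
    (j : Fin N) :
    ∑ k : Fin N, hMatZ M (a + k) * shiftMat M k j = hMatZ M (a + 1 + j) := by
  simp only [shiftMat, Matrix.of_apply, mul_add, Finset.sum_add_distrib]
  by_cases hj : (j : ℕ) + 1 = N
  · have h0 : ∀ k : Fin N, ¬ (k : ℕ) = j + 1 := fun k => by have := k.2; omega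
    have h := sum_charpolyRev_coeff_mul_hMatZ M ha
    rw [← Finset.sum_range_reflect, Finset.sum_range_succ] at h
    simp only [h0, if_false, mul_zero, Finset.sum_const_zero, zero_add]
    simp only [hj, if_true]
    rw [Finset.sum_fin_eq_sum_range]
    have e : (a + 1 + (j : ℕ) : ℤ) = a + N := by omega
    rw [e]
    have h1 : M.charpolyRev.coeff 0 = 1 := by
      rw [Polynomial.coeff_zero_eq_eval_zero, Matrix.eval_charpolyRev]
    simp only [Nat.add_sub_cancel, Nat.sub_self, Nat.cast_zero, sub_zero, h1, one_mul] at h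
    rw [add_comm, ← eq_neg_iff_add_eq_zero] at h
    rw [h, ← Finset.sum_neg_distrib]
    refine Finset.sum_congr rfl fun k hk => ?_
    simp at hk
    rw [dif_pos hk, Nat.cast_sub hk.le]
    simp only
    rw [show a + (N : ℤ) - ((N : ℤ) - k) = a + k by ring]
    ring
  · have hj2 : (j : ℕ) + 1 < N := by have := j.2; omega
    rw [Finset.sum_eq_single (⟨j + 1, hj2⟩ : Fin N)]
    · simp [hj]
      ring_nf
    · intro b _ hb
      rw [if_neg fun h => hb (Fin.ext h), mul_zero]
    · simp

theorem det_one_add_smul_eq_sum_charpolyRev_coeff (M : Matrix (Fin N) (Fin N) ℂ) (t : ℂ) :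
    (1 + t • M).det = ∑ j ∈ Finset.range (N + 1), M.charpolyRev.coeff j * (-t) ^ j := by
  rw [← Polynomial.eval_eq_sum_range' (Nat.lt_succ_of_le (natDegree_charpolyRev_le M)),
    Matrix.charpolyRev, ← Polynomial.coe_evalRingHom, RingHom.map_det]
  congr 1
  ext i j
  by_cases h : i = j <;> simp [h] <;> ring

theorem det_one_add_smul_shiftMat (M : Matrix (Fin N) (Fin N) ℂ) (t : ℂ) :
    (1 + t • shiftMat M).det = (1 + t • M).det := by
  set L : Matrix (Fin N) (Fin N) ℂ :=
    Matrix.of fun i j => if (j : ℕ) ≤ i then (-t) ^ ((i : ℕ) - j) else 0 with hL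
  have hLdet : L.det = 1 := by
    rw [Matrix.det_of_isLowerTriangular]
    · simp [hL]
    · intro i j hij
      have : (i : ℕ) < j := hij
      simp only [hL, Matrix.of_apply]
      rw [if_neg (by omega)]
  set c : Fin N → ℂ := fun k => -M.charpolyRev.coeff (N - k) with hc
  set v : Fin N → ℂ := fun j => if (j : ℕ) + 1 = N then 1 else 0 with hv
  have hmul : L * (1 + t • shiftMat M) =
      1 + replicateCol Unit (t • (L *ᵥ c)) * replicateRow Unit v := by
    ext i j
    have h1 : (L * shiftMat M) i j =
        (if h : (j : ℕ) + 1 < N then L i ⟨j + 1, h⟩ else 0) + (L *ᵥ c) i * v j := by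
      simp only [Matrix.mul_apply, shiftMat, Matrix.of_apply, mul_add, Finset.sum_add_distrib]
      congr 1
      · split_ifs with h
        · rw [Finset.sum_eq_single (⟨j + 1, h⟩ : Fin N)]
          · simp
          · intro b _ hb
            rw [if_neg fun h => hb (Fin.ext h), mul_zero]
          · simp
        · refine Finset.sum_eq_zero fun k _ => ?_
          rw [if_neg (by have := k.2; omega), mul_zero]
      · by_cases h : (j : ℕ) + 1 = N <;> simp [hv, h, hc, Matrix.mulVec, dotProduct]
    rw [Matrix.mul_add, Matrix.mul_one, Matrix.mul_smul, Matrix.add_apply, Matrix.smul_apply, h1,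
      Matrix.add_apply, Matrix.mul_apply]
    simp only [Finset.univ_unique, Finset.sum_singleton, replicateCol_apply, replicateRow_apply,
      Pi.smul_apply, smul_eq_mul, mul_add, ← add_assoc, mul_assoc]
    congr 1
    have hi := i.2
    rcases lt_trichotomy (i : ℕ) j with h | h | h
    · have h2 : i ≠ j := fun e => by simp [e] at h
      have h3 : ¬ (j : ℕ) ≤ i := by omega
      have h4 : ¬ (j : ℕ) + 1 ≤ i := by omega
      simp only [hL, Matrix.one_apply_ne h2, h3, h4, Matrix.of_apply, if_false, dite_eq_ite,
        ite_self, mul_zero, zero_add]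
    · have h2 : i = j := Fin.ext h
      have h4 : ¬ (j : ℕ) + 1 ≤ i := by omega
      subst h2
      simp only [hL, h4, Matrix.of_apply, if_false, dite_eq_ite, ite_self, mul_zero, le_refl,
        if_true, Nat.sub_self, pow_zero, Matrix.one_apply_eq, add_zero]
    · have h2 : i ≠ j := fun e => by simp [e] at h
      have h3 : (j : ℕ) ≤ i := by omega
      have h4 : (j : ℕ) + 1 ≤ i := by omega
      have h5 : (j : ℕ) + 1 < N := by omega
      simp only [hL, Matrix.one_apply_ne h2, h3, h4, h5, Matrix.of_apply, if_true, dif_pos]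
      rw [show (i : ℕ) - j = (i - (j + 1)) + 1 by omega, pow_succ]
      ring
  have h := congrArg Matrix.det hmul
  rw [Matrix.det_mul, hLdet, one_mul, Matrix.det_one_add_replicateCol_mul_replicateRow] at h
  rw [h, det_one_add_smul_eq_sum_charpolyRev_coeff, ← Finset.sum_range_reflect,
    Finset.sum_range_succ, Nat.add_sub_cancel, Nat.sub_self, pow_zero, mul_one,
    Polynomial.coeff_zero_eq_eval_zero, Matrix.eval_charpolyRev, add_comm]
  congr 1
  rcases Nat.eq_zero_or_pos N with h0 | h0
  · subst h0
    simp
  · rw [dotProduct, Finset.sum_eq_single (⟨N - 1, by omega⟩ : Fin N)]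
    · simp only [hv, Nat.sub_add_cancel h0, if_true, one_mul, Pi.smul_apply, smul_eq_mul,
        Matrix.mulVec, dotProduct]
      rw [Finset.sum_fin_eq_sum_range, Finset.mul_sum]
      refine Finset.sum_congr rfl fun k hk => ?_
      simp at hk
      rw [dif_pos hk]
      simp only [hL, hc, Matrix.of_apply]
      rw [if_pos (by omega), show N - k = (N - 1 - k) + 1 by omega, pow_succ]
      ring
    · intro b _ hb
      have : ¬ (b : ℕ) + 1 = N := fun e => hb (Fin.ext (by simp; omega))
      simp [hv, this]
    · simp

theorem det_add_smul_rows (A B : Matrix (Fin N) (Fin N) ℂ) (t : ℂ) :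
    (A + t • B).det = ∑ S : Finset (Fin N), t ^ S.card *
      (Matrix.of fun i => if i ∈ S then B i else A i).det := by
  have h := (Matrix.detRowAlternating (n := Fin N) (R := ℂ)).toMultilinearMap.map_add_univ
    (t • B) A
  rw [add_comm A]
  refine h.trans (Finset.sum_congr rfl fun S _ => ?_)
  have h2 := (Matrix.detRowAlternating (n := Fin N) (R := ℂ)).toMultilinearMap.map_piecewise_smul
    (fun _ => t) (S.piecewise B A) S
  simp only [Finset.prod_const, smul_eq_mul] at h2
  refine Eq.trans ?_ (h2.trans ?_)
  · congr 1
    ext i j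
    by_cases hi : i ∈ S <;> simp [hi, Finset.piecewise]
  · rfl

/-- Pieri's rule for multiplication by elementary symmetric functions. -/
theorem sum_pow_mul_schur_add_indicator (l : Fin N → ℕ) (M : Matrix (Fin N) (Fin N) ℂ) (t : ℂ) :
    ∑ S : Finset (Fin N), t ^ S.card * schur (fun i => l i + if i ∈ S then 1 else 0) M =
      (1 + t • M).det * schur l M := by
  rw [← det_one_add_smul_shiftMat, mul_comm, schur, ← Matrix.det_mul, Matrix.mul_add,
    Matrix.mul_one, Matrix.mul_smul, det_add_smul_rows]
  refine Finset.sum_congr rfl fun S _ => ?_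
  rw [schur]
  congr 2
  ext i j
  by_cases hi : i ∈ S
  · simp only [Matrix.of_apply, hi, if_true, Matrix.mul_apply]
    rw [sum_hMatZ_mul_shiftMat M (by have := i.2; omega)]
    congr 1
    push_cast
    ring
  · simp [hi]

theorem sum_powersetCard_eq_of_forall_sum_pow_mul_eq {f g : Finset (Fin N) → ℂ}
    (h : ∀ t : ℂ, ∑ S, t ^ S.card * f S = ∑ S, t ^ S.card * g S) (k : ℕ) :
    ∑ S ∈ Finset.powersetCard k Finset.univ, f S =
      ∑ S ∈ Finset.powersetCard k Finset.univ, g S := by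
  have h1 : ∀ f : Finset (Fin N) → ℂ, ∑ S ∈ Finset.powersetCard k Finset.univ, f S =
      (∑ S : Finset (Fin N), Polynomial.X ^ S.card * Polynomial.C (f S)).coeff k := by
    intro f
    rw [Polynomial.finsetSum_coeff]
    simp only [Polynomial.coeff_X_pow_mul', Polynomial.coeff_C]
    rw [← Finset.sum_subset (Finset.subset_univ (Finset.powersetCard k Finset.univ))]
    · refine Finset.sum_congr rfl fun S hS => ?_
      simp [(Finset.mem_powersetCard.1 hS).2]
    · intro S _ hS
      simp only [Finset.mem_powersetCard, Finset.subset_univ, true_and] at hS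
      split_ifs with h1 h2
      · omega
      · rfl
      · rfl
  rw [h1, h1]
  congr 1
  refine Polynomial.funext fun t => ?_
  have h2 := h t
  simp only [mul_comm (t ^ _)] at h2
  simpa [Polynomial.eval_finsetSum] using h2

/-- The elementary symmetric functions of the eigenvalues of a matrix, as sums of principal
minors. -/
def eMat (k : ℕ) (M : Matrix (Fin N) (Fin N) ℂ) : ℂ :=
  ∑ S ∈ Finset.powersetCard k (Finset.univ : Finset (Fin N)),
    (Matrix.of fun i => if i ∈ S then M i else (1 : Matrix (Fin N) (Fin N) ℂ) i).det

theorem eMat_mul_comm (k : ℕ) (A B : Matrix (Fin N) (Fin N) ℂ) :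
    eMat k (A * B) = eMat k (B * A) := by
  refine sum_powersetCard_eq_of_forall_sum_pow_mul_eq (fun t => ?_) k
  rw [← det_add_smul_rows, ← det_add_smul_rows, ← Matrix.smul_mul, Matrix.det_one_add_mul_comm,
    Matrix.mul_smul]

theorem eMat_diagonal_mul (k : ℕ) (s : Fin N → ℂ) (K : Matrix (Fin N) (Fin N) ℂ) :
    eMat k (Matrix.diagonal s * K) =
      ∑ S ∈ Finset.powersetCard k (Finset.univ : Finset (Fin N)), (∏ i ∈ S, s i) *
        (Matrix.of fun i => if i ∈ S then K i else (1 : Matrix (Fin N) (Fin N) ℂ) i).det := by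
  refine Finset.sum_congr rfl fun S _ => ?_
  have h := Matrix.det_mul_column (fun i => if i ∈ S then s i else 1)
    (Matrix.of fun i => if i ∈ S then K i else (1 : Matrix (Fin N) (Fin N) ℂ) i)
  rw [Finset.prod_ite_mem, Finset.univ_inter] at h
  rw [← h]
  congr 1
  ext i j
  by_cases hi : i ∈ S <;> simp [hi, Matrix.diagonal_mul]

/-- Pieri's rule for multiplication by a single elementary symmetric function. -/
theorem sum_schur_add_indicator (k : ℕ) (l : Fin N → ℕ) (M : Matrix (Fin N) (Fin N) ℂ) :
    ∑ S ∈ Finset.powersetCard k (Finset.univ : Finset (Fin N)),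
      schur (fun i => l i + if i ∈ S then 1 else 0) M = eMat k M * schur l M := by
  rw [eMat, Finset.sum_mul]
  refine sum_powersetCard_eq_of_forall_sum_pow_mul_eq (fun t => ?_) k
  rw [sum_pow_mul_schur_add_indicator, det_add_smul_rows, Finset.sum_mul]
  simp only [mul_assoc]

theorem schur_zero (M : Matrix (Fin N) (Fin N) ℂ) : schur 0 M = 1 := by
  rw [schur, Matrix.det_of_isUpperTriangular]
  · simp [hMatZ, hMat_zero]
  · intro i j hij
    have : (j : ℕ) < i := hij
    simp only [Matrix.of_apply, Pi.zero_apply]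
    exact hMatZ_of_neg _ (by push_cast; omega)

theorem antitone_or_exists_succ_of_add_indicator {l : Fin N → ℕ} (hl : Antitone l)
    (S : Finset (Fin N)) :
    Antitone (fun i => l i + if i ∈ S then 1 else 0) ∨ ∃ i j : Fin N, (j : ℕ) = i + 1 ∧
      (l j + if j ∈ S then 1 else 0) = (l i + if i ∈ S then 1 else 0) + 1 := by
  by_cases h : ∀ i j : Fin N, (j : ℕ) = i + 1 →
    (l j + if j ∈ S then 1 else 0) ≤ (l i + if i ∈ S then 1 else 0)
  · left
    rcases N with _ | n
    · intro i; exact i.elim0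
    · rw [Fin.antitone_iff_succ_le]
      intro i
      exact h _ _ (by simp)
  · right
    push Not at h
    obtain ⟨i, j, hij, h⟩ := h
    refine ⟨i, j, hij, ?_⟩
    have := hl (show i ≤ j from Fin.le_def.2 (by omega))
    split_ifs at h ⊢ <;> omega

theorem det_jacobiTrudi_eq_zero (f : ℤ → ℂ) {l : Fin N → ℕ} {i j : Fin N} (hij : (j : ℕ) = i + 1)
    (h : l j = l i + 1) :
    (Matrix.of fun i j : Fin N => f ((l i : ℤ) - (i : ℤ) + (j : ℤ))).det = 0 := by
  refine Matrix.det_zero_of_row_eq (i := i) (j := j) (fun e => by simp [e] at hij) ?_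
  ext k
  simp only [Matrix.of_apply]
  congr 1
  omega

/-- Partial sums of a sequence of parts. -/
def partSum (l : Fin N → ℕ) (k : ℕ) : ℕ := ∑ i : Fin N, if (i : ℕ) < k then l i else 0

theorem partSum_zero (l : Fin N → ℕ) : partSum l 0 = 0 := by simp [partSum]

theorem partSum_succ (l : Fin N → ℕ) (k : Fin N) :
    partSum l (k + 1) = partSum l k + l k := by
  rw [partSum, partSum]
  have : l k = ∑ i, if i = k then l k else 0 := by simp
  rw [this, ← Finset.sum_add_distrib]
  refine Finset.sum_congr rfl fun i _ => ?_
  by_cases hik : i = k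
  · simp [hik]
  · have : (i : ℕ) ≠ k := fun e => hik (Fin.ext e)
    simp only [hik, if_false, add_zero]
    congr 1
    simp only [eq_iff_iff]
    omega

theorem partSum_add (l l' : Fin N → ℕ) (k : ℕ) :
    partSum (fun i => l i + l' i) k = partSum l k + partSum l' k := by
  rw [partSum, partSum, partSum, ← Finset.sum_add_distrib]
  exact Finset.sum_congr rfl fun i _ => by split_ifs <;> rfl

theorem eq_of_partSum_eq {l l' : Fin N → ℕ} (h : ∀ k ≤ N, partSum l k = partSum l' k) :
    l = l' := by
  ext k
  have h1 := partSum_succ l k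
  have h2 := partSum_succ l' k
  rw [h _ (by omega), h _ (by omega)] at h1
  omega

theorem partSum_indicator_le (S : Finset (Fin N)) (k : ℕ) :
    partSum (fun i => if i ∈ S then 1 else 0) k ≤ min k S.card := by
  rw [partSum]
  have h : (∑ i : Fin N, if (i : ℕ) < k then (if i ∈ S then 1 else 0) else 0) =
      (S.filter fun i : Fin N => (i : ℕ) < k).card := by
    rw [Finset.card_filter, ← Finset.sum_filter, ← Finset.sum_filter, ← Finset.sum_filter]
    congr 1
    ext i
    simp [and_comm]
  rw [h]
  refine le_min ?_ (Finset.card_filter_le _ _)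
  calc (S.filter fun i : Fin N => (i : ℕ) < k).card
      = ((S.filter fun i : Fin N => (i : ℕ) < k).image fun i : Fin N => (i : ℕ)).card :=
        (Finset.card_image_of_injective _ Fin.val_injective).symm
    _ ≤ (Finset.range k).card := Finset.card_le_card (by intro x; simp; omega)
    _ = k := Finset.card_range k

theorem min_le_partSum_support {l : Fin N → ℕ} (hl : Antitone l) (k : ℕ) :
    min k (Finset.univ.filter fun i => 0 < l i).card ≤
      partSum (fun i => if i ∈ Finset.univ.filter (fun i => 0 < l i) then 1 else 0) k := by
  by_cases h : ∃ i : Fin N, 0 < l i ∧ k ≤ i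
  · obtain ⟨i, hi, hki⟩ := h
    refine (min_le_left _ _).trans ?_
    have : ∀ m ≤ k, partSum (fun i => if i ∈ Finset.univ.filter (fun i => 0 < l i) then 1 else 0) m
        = m := by
      intro m hm
      induction m with
      | zero => exact partSum_zero _
      | succ m ih =>
        have hmN : m < N := by have := i.2; omega
        have := partSum_succ (fun i => if i ∈ Finset.univ.filter (fun i => 0 < l i) then 1 else 0)
          ⟨m, hmN⟩
        have hm2 : 0 < l ⟨m, hmN⟩ := hi.trans_le (hl (Fin.le_def.2 (by simp; omega)))
        simp only [] at this
        rw [this, ih (by omega)]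
        simp [hm2]
    exact (this k le_rfl).ge
  · push Not at h
    refine (min_le_right _ _).trans ?_
    rw [partSum, Finset.card_filter]
    refine Finset.sum_le_sum fun i _ => ?_
    by_cases hi : 0 < l i
    · simp [hi, h i hi]
    · simp [hi]

/-- The span of products of elementary symmetric functions whose column heights are
dominated by the partial sums of `l`. -/
def eSpan (l : Fin N → ℕ) : Submodule ℂ (Matrix (Fin N) (Fin N) ℂ → ℂ) :=
  Submodule.span ℂ {f | ∃ c : List ℕ, (∀ k, (c.map (min k)).sum ≤ partSum l k) ∧
    f = fun M => (c.map fun r => eMat r M).prod}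

theorem eSpan_mono {l l' : Fin N → ℕ} (h : ∀ k, partSum l k ≤ partSum l' k) :
    eSpan l ≤ eSpan l' := by
  refine Submodule.span_mono ?_
  rintro f ⟨c, hc, rfl⟩
  exact ⟨c, fun k => (hc k).trans (h k), rfl⟩

theorem eMat_mul_mem_eSpan {l l' : Fin N → ℕ} {r : ℕ}
    (h : ∀ k, min k r + partSum l k ≤ partSum l' k) {f : Matrix (Fin N) (Fin N) ℂ → ℂ}
    (hf : f ∈ eSpan l) : (fun M => eMat r M * f M) ∈ eSpan l' := by
  induction hf using Submodule.span_induction with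
  | mem f hf =>
    obtain ⟨c, hc, rfl⟩ := hf
    refine Submodule.subset_span ⟨r :: c, fun k => ?_, ?_⟩
    · rw [List.map_cons, List.sum_cons]
      exact (Nat.add_le_add_left (hc k) _).trans (h k)
    · simp
  | zero => simp only [Pi.zero_apply, mul_zero]; exact (eSpan l').zero_mem
  | add f g _ _ hf hg =>
    convert (eSpan l').add_mem hf hg using 1
    ext M
    simp [mul_add]
  | smul a f _ hf =>
    convert (eSpan l').smul_mem a hf using 1
    ext M
    simp [mul_left_comm]

theorem sum_partSum_lt {l l' : Fin N → ℕ} (h : ∀ k, partSum l k ≤ partSum l' k) (hne : l ≠ l') :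
    ∑ k ∈ Finset.range (N + 1), partSum l k < ∑ k ∈ Finset.range (N + 1), partSum l' k := by
  refine Finset.sum_lt_sum (fun k _ => h k) ?_
  by_contra! hcon
  exact hne (eq_of_partSum_eq fun k hk => le_antisymm (h k) (hcon k (by simp; omega)))

theorem schur_mem_eSpan (l : Fin N → ℕ) (hl : Antitone l) : schur l ∈ eSpan l := by
  induction hn : ∑ k ∈ Finset.range (N + 1), partSum l k using Nat.strong_induction_on
    generalizing l with
  | _ n ih =>
    subst hn
    by_cases h0 : l = 0
    · subst h0
      refine Submodule.subset_span ⟨[], by simp, ?_⟩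
      ext M
      simp [schur_zero]
    set R : Finset (Fin N) := Finset.univ.filter fun i => 0 < l i with hR
    set l₀ : Fin N → ℕ := fun i => l i - 1 with hl₀
    have hl0R : (fun i => l₀ i + if i ∈ R then 1 else 0) = l := by
      ext i
      by_cases hi : 0 < l i <;> simp [hR, hl₀, hi] <;> omega
    have hps : ∀ k, min k R.card + partSum l₀ k ≤ partSum l k := by
      intro k
      conv_rhs => rw [← hl0R, partSum_add]
      have := min_le_partSum_support hl k
      rw [← hR] at this
      omega
    have hanti : Antitone l₀ := fun i j hij => Nat.sub_le_sub_right (hl hij) 1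
    have hne0 : l₀ ≠ l := by
      obtain ⟨i, hi⟩ := Function.ne_iff.1 h0
      intro h
      have := congrFun h i
      simp [hl₀] at this hi
      omega
    have h1 := eMat_mul_mem_eSpan hps (ih _ (sum_partSum_lt
      (fun k => le_trans (Nat.le_add_left _ _) (hps k)) hne0) l₀ hanti rfl)
    have hRmem : R ∈ Finset.powersetCard R.card (Finset.univ : Finset (Fin N)) := by
      simp [Finset.mem_powersetCard]
    have h2 : schur l = (fun M => eMat R.card M * schur l₀ M) -
        ∑ S ∈ (Finset.powersetCard R.card (Finset.univ : Finset (Fin N))).erase R,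
          schur (fun i => l₀ i + if i ∈ S then 1 else 0) := by
      ext M
      rw [Pi.sub_apply, ← sum_schur_add_indicator, ← Finset.add_sum_erase _ _ hRmem,
        Finset.sum_apply, add_sub_cancel_right, hl0R]
    rw [h2]
    refine Submodule.sub_mem _ h1 (Submodule.sum_mem _ fun S hS => ?_)
    obtain ⟨hSR, hS⟩ := Finset.mem_erase.1 hS
    have hScard := (Finset.mem_powersetCard.1 hS).2
    rcases antitone_or_exists_succ_of_add_indicator hanti S with h | ⟨i, j, hij, h⟩
    · have hle : ∀ k, partSum (fun i => l₀ i + if i ∈ S then 1 else 0) k ≤ partSum l k := by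
        intro k
        rw [partSum_add]
        have := partSum_indicator_le S k
        have := hps k
        rw [hScard] at *
        omega
      refine eSpan_mono hle (ih _ (sum_partSum_lt hle ?_) _ h rfl)
      intro he
      rw [← hl0R] at he
      refine hSR ?_
      ext i
      have := congrFun he i
      simp only [add_right_inj] at this
      by_cases h1 : i ∈ S <;> by_cases h2 : i ∈ R <;> simp_all
    · have : schur (fun i => l₀ i + if i ∈ S then 1 else 0) =
          (0 : Matrix (Fin N) (Fin N) ℂ → ℂ) := by
        ext M
        exact det_jacobiTrudi_eq_zero (hMatZ M) hij h
      rw [this]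
      exact Submodule.zero_mem _

theorem eMat_one (M : Matrix (Fin N) (Fin N) ℂ) : eMat 1 M = M.trace := by
  rw [eMat, Finset.powersetCard_one, Finset.sum_map]
  refine Finset.sum_congr rfl fun i _ => ?_
  have h : (Matrix.of fun j => if j ∈ ({i} : Finset (Fin N)) then M j
      else (1 : Matrix (Fin N) (Fin N) ℂ) j) = (1 : Matrix (Fin N) (Fin N) ℂ).updateRow i (M i) := by
    ext j k
    by_cases hj : j = i
    · subst hj; simp
    · simp [hj]
  simp only [Function.Embedding.coeFn_mk]
  rw [h, ← Matrix.cramer_transpose_apply, Matrix.transpose_one, Matrix.cramer_one]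
  rfl

theorem mul_factInvZ (k : ℤ) : (k : ℂ) * factInvZ k = factInvZ (k - 1) := by
  rcases lt_trichotomy k 0 with h | h | h
  · rw [factInvZ, factInvZ, if_pos h, if_pos (by omega), mul_zero]
  · subst h
    simp [factInvZ]
  · lift k to ℕ using h.le
    obtain ⟨m, rfl⟩ : ∃ m, k = m + 1 := ⟨k - 1, by omega⟩
    have h1 : (m : ℂ) + 1 ≠ 0 := Nat.cast_add_one_ne_zero m
    have h2 : ((m + 1 : ℕ) : ℤ) - 1 = m := by push_cast; ring
    rw [h2, factInvZ, factInvZ, if_neg (by omega), if_neg (by omega)]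
    simp only [Int.toNat_natCast, Nat.factorial_succ]
    push_cast
    field_simp

theorem sum_mul_det_factInvZ (a : Fin N → ℤ) :
    ((∑ i : Fin N, (a i + i) : ℤ) : ℂ) * (Matrix.of fun i j : Fin N => factInvZ (a i + j)).det =
      ∑ i, (Matrix.of fun k j : Fin N => factInvZ ((if k = i then a k - 1 else a k) + j)).det := by
  simp_rw [Matrix.det_apply', Matrix.of_apply]
  rw [Finset.sum_comm, Finset.mul_sum]
  refine Finset.sum_congr rfl fun σ _ => ?_
  rw [← Finset.mul_sum, mul_left_comm]
  congr 1
  have h : (∑ i : Fin N, (a i + i) : ℤ) = ∑ i : Fin N, (a (σ i) + i) := by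
    rw [Finset.sum_add_distrib, Finset.sum_add_distrib, Equiv.sum_comp σ a]
  rw [h, Int.cast_sum, Finset.sum_mul]
  refine Eq.trans (Finset.sum_congr rfl fun i _ => ?_) (Equiv.sum_comp σ _)
  rw [← Finset.mul_prod_erase Finset.univ _ (Finset.mem_univ i),
    ← Finset.mul_prod_erase Finset.univ _ (Finset.mem_univ i), ← mul_assoc, mul_factInvZ,
    if_pos rfl]
  congr 1
  · congr 1
    ring
  · refine Finset.prod_congr rfl fun j hj => ?_
    rw [if_neg fun h => Finset.ne_of_mem_erase hj (σ.injective h)]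

/-- Adding a box to row `i`. -/
def addBox (l : Fin N → ℕ) (i : Fin N) : Fin N → ℕ :=
  fun j => l j + if j ∈ ({i} : Finset (Fin N)) then 1 else 0

/-- Removing a box from row `i`. -/
def removeBox (l : Fin N → ℕ) (i : Fin N) : Fin N → ℕ :=
  fun j => l j - if j ∈ ({i} : Finset (Fin N)) then 1 else 0

theorem removeBox_addBox (l : Fin N → ℕ) (i : Fin N) : removeBox (addBox l i) i = l := by
  ext j
  simp [removeBox, addBox]

theorem addBox_removeBox {l : Fin N → ℕ} {i : Fin N} (h : 0 < l i) :
    addBox (removeBox l i) i = l := by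
  ext j
  by_cases hj : j = i
  · subst hj
    simp [removeBox, addBox]
    omega
  · simp [removeBox, addBox, hj]

theorem sum_addBox (l : Fin N → ℕ) (i : Fin N) : ∑ j, addBox l i j = ∑ j, l j + 1 := by
  simp [addBox, Finset.sum_add_distrib]

theorem antitone_removeBox {l : Fin N → ℕ} (hl : Antitone l) {i : Fin N}
    (h : ∀ j : Fin N, (j : ℕ) = i + 1 → l j < l i) : Antitone (removeBox l i) := by
  intro x y hxy
  have h1 := hl hxy
  simp only [removeBox, Finset.mem_singleton]
  by_cases hx : x = i
  · subst hx
    by_cases hy : y = x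
    · simp [hy]
    · have hlt : (x : ℕ) < y := lt_of_le_of_ne hxy fun e => hy (Fin.ext e.symm)
      have h2 := h ⟨x + 1, by omega⟩ rfl
      have h3 : l y ≤ l ⟨x + 1, by omega⟩ := hl (Fin.le_def.2 (by simp; omega))
      simp only [hy, if_true, if_false]
      omega
  · simp only [hx, if_false]
    omega

theorem sum_mul_schurPInf {l : Fin N → ℕ} (hl : Antitone l) :
    ((∑ i, l i : ℕ) : ℂ) * schurPInf l =
      ∑ i ∈ Finset.univ.filter (fun i => 0 < l i ∧ Antitone (removeBox l i)),
        schurPInf (removeBox l i) := by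
  have h := sum_mul_det_factInvZ (fun i : Fin N => (l i : ℤ) - i)
  have h1 : ((∑ i : Fin N, ((l i : ℤ) - i + i) : ℤ) : ℂ) = ((∑ i, l i : ℕ) : ℂ) := by
    simp
  rw [h1] at h
  rw [schurPInf, h, Finset.sum_filter]
  refine Finset.sum_congr rfl fun i _ => ?_
  split_ifs with hi
  · rw [schurPInf]
    congr 2
    ext k j
    congr 2
    have := hi.1
    by_cases hk : k = i
    · subst hk
      simp only [removeBox, Finset.mem_singleton, if_true]
      omega
    · simp [removeBox, hk]
  · by_cases hlast : (i : ℕ) + 1 < N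
    · set j : Fin N := ⟨i + 1, hlast⟩ with hj
      have hji : l j ≤ l i := hl (Fin.le_def.2 (by simp [hj]))
      have hij : j ≠ i := fun e => by simpa [hj] using congrArg Fin.val e
      have heq : l j = l i := by
        by_contra hne
        refine hi ⟨by omega, antitone_removeBox hl fun k hk => ?_⟩
        have : k = j := Fin.ext hk
        rw [this]
        omega
      refine Matrix.det_zero_of_row_eq hij ?_
      ext k
      simp only [Matrix.of_apply, hij, if_true, if_false, heq]
      congr 1
      simp [hj]
      ring
    · have h0 : l i = 0 := by
        by_contra hne
        refine hi ⟨by omega, antitone_removeBox hl fun k hk => ?_⟩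
        have := k.2
        omega
      refine Matrix.det_eq_zero_of_row_eq_zero i fun j => ?_
      have := j.2
      simp only [Matrix.of_apply, if_true, h0, factInvZ]
      rw [if_pos (by omega)]

theorem schurPInf_zero : schurPInf (0 : Fin N → ℕ) = 1 := by
  rw [schurPInf, Matrix.det_of_isUpperTriangular]
  · simp [factInvZ]
  · intro i j hij
    have : (j : ℕ) < i := hij
    simp only [Matrix.of_apply, Pi.zero_apply, factInvZ]
    rw [if_pos (by push_cast; omega)]

open scoped ComplexOrder in
theorem schurPInf_pos {l : Fin N → ℕ} (hl : Antitone l) : 0 < schurPInf l := by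
  induction hn : ∑ i, l i generalizing l with
  | zero =>
    have : l = 0 := by
      ext i
      simpa using Finset.sum_eq_zero_iff.1 hn i (Finset.mem_univ i)
    rw [this, schurPInf_zero]
    exact one_pos
  | succ n ih =>
    have h := sum_mul_schurPInf hl
    rw [hn] at h
    have hn0 : (0 : ℂ) < ((n + 1 : ℕ) : ℂ) := by exact_mod_cast Nat.succ_pos n
    refine pos_of_mul_pos_right ?_ hn0.le
    rw [h]
    refine Finset.sum_pos ?_ ?_
    · intro i hi
      simp only [Finset.mem_filter, Finset.mem_univ, true_and] at hi
      refine ih hi.2 ?_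
      have := sum_addBox (removeBox l i) i
      rw [addBox_removeBox hi.1] at this
      omega
    · have hne : (Finset.univ.filter fun i => 0 < l i).Nonempty := by
        by_contra hcon
        rw [Finset.not_nonempty_iff_eq_empty, Finset.filter_eq_empty_iff] at hcon
        rw [Finset.sum_eq_zero fun i hi => by simpa using hcon hi] at hn
        omega
      set i := (Finset.univ.filter fun i => 0 < l i).max' hne with hi
      have him : 0 < l i := by simpa using Finset.max'_mem _ hne
      refine ⟨i, Finset.mem_filter.2 ⟨Finset.mem_univ _, him,
        antitone_removeBox hl fun j hj => ?_⟩⟩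
      have hj0 : ¬ 0 < l j := fun h0 => by
        have h2 : j ≤ i := Finset.le_max' _ j (by simp [h0])
        have h3 : (j : ℕ) ≤ i := h2
        omega
      omega

/-- Partitions of `n` with at most `N` parts. -/
def partitionFinset (N n : ℕ) : Finset (Fin N → ℕ) :=
  (Finset.piAntidiag Finset.univ n).filter Antitone

theorem mem_partitionFinset {n : ℕ} {l : Fin N → ℕ} :
    l ∈ partitionFinset N n ↔ ∑ i, l i = n ∧ Antitone l := by
  simp [partitionFinset]

/-- The expansion of a power of the trace in Schur polynomials. -/
theorem trace_pow_eq_sum_schur (M : Matrix (Fin N) (Fin N) ℂ) (n : ℕ) :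
    M.trace ^ n = (n.factorial : ℂ) * ∑ l ∈ partitionFinset N n, schurPInf l * schur l M := by
  induction n with
  | zero =>
    have : partitionFinset N 0 = {0} := by
      ext l
      rw [mem_partitionFinset, Finset.mem_singleton]
      constructor
      · rintro ⟨h, -⟩
        ext i
        simpa using Finset.sum_eq_zero_iff.1 h i (Finset.mem_univ i)
      · rintro rfl
        exact ⟨by simp, antitone_const⟩
    simp [this, schurPInf_zero, schur_zero]
  | succ n ih =>
    have hp : ∀ l : Fin N → ℕ, Antitone l → M.trace * schur l M =
        ∑ i ∈ Finset.univ.filter (fun i => Antitone (addBox l i)), schur (addBox l i) M := by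
      intro l hl
      rw [← eMat_one, ← sum_schur_add_indicator, Finset.powersetCard_one, Finset.sum_map,
        Finset.sum_filter]
      refine Finset.sum_congr rfl fun i _ => ?_
      split_ifs with h
      · rfl
      · obtain ⟨a, b, hab, hv⟩ := (antitone_or_exists_succ_of_add_indicator hl {i}).resolve_left h
        exact det_jacobiTrudi_eq_zero (hMatZ M) hab hv
    rw [pow_succ, ih, Nat.factorial_succ, mul_assoc, Nat.cast_mul, mul_comm (((n + 1 : ℕ) : ℂ)),
      mul_assoc]
    congr 1
    rw [Finset.sum_mul, Finset.mul_sum]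
    have h1 : ∀ l ∈ partitionFinset N n, schurPInf l * schur l M * M.trace =
        ∑ i ∈ Finset.univ.filter (fun i => Antitone (addBox l i)),
          schurPInf l * schur (addBox l i) M := by
      intro l hl
      rw [mul_assoc, mul_comm (schur l M), hp l (mem_partitionFinset.1 hl).2, Finset.mul_sum]
    have h2 : ∀ l ∈ partitionFinset N (n + 1), ((n + 1 : ℕ) : ℂ) * (schurPInf l * schur l M) =
        ∑ i ∈ Finset.univ.filter (fun i => 0 < l i ∧ Antitone (removeBox l i)),
          schurPInf (removeBox l i) * schur l M := by
      intro l hl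
      rw [mem_partitionFinset] at hl
      rw [← mul_assoc, ← hl.1, sum_mul_schurPInf hl.2, Finset.sum_mul]
    rw [Finset.sum_congr rfl h1, Finset.sum_congr rfl h2, Finset.sum_sigma', Finset.sum_sigma']
    refine Finset.sum_bij' (fun x _ => ⟨addBox x.1 x.2, x.2⟩) (fun x _ => ⟨removeBox x.1 x.2, x.2⟩)
      ?_ ?_ ?_ ?_ ?_
    · rintro ⟨l, i⟩ h
      simp only [Finset.mem_sigma, Finset.mem_filter, Finset.mem_univ, true_and,
        mem_partitionFinset] at h ⊢
      refine ⟨⟨by rw [sum_addBox, h.1.1], h.2⟩, by simp [addBox], ?_⟩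
      rw [removeBox_addBox]
      exact h.1.2
    · rintro ⟨l, i⟩ h
      simp only [Finset.mem_sigma, Finset.mem_filter, Finset.mem_univ, true_and,
        mem_partitionFinset] at h ⊢
      have := sum_addBox (removeBox l i) i
      rw [addBox_removeBox h.2.1] at this ⊢
      exact ⟨⟨by omega, h.2.2⟩, h.1.2⟩
    · rintro ⟨l, i⟩ h
      simp [removeBox_addBox]
    · rintro ⟨l, i⟩ h
      simp only [Finset.mem_sigma, Finset.mem_filter, Finset.mem_univ, true_and,
        mem_partitionFinset] at h
      simp [addBox_removeBox h.2.1]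
    · rintro ⟨l, i⟩ h
      simp [removeBox_addBox]

/-- The functional on polynomials in two families of variables pairing the monomials in the first
family with those in the second as a complex Gaussian measure does. -/
def gaussPairing (N : ℕ) : MvPolynomial (Fin N ⊕ Fin N) ℂ →ₗ[ℂ] ℂ :=
  (MvPolynomial.basisMonomials (Fin N ⊕ Fin N) ℂ).constr ℂ fun s =>
    if ∀ a, s (Sum.inl a) = s (Sum.inr a) then ∏ a, ((s (Sum.inl a)).factorial : ℂ) else 0

theorem gaussPairing_monomial (s : Fin N ⊕ Fin N →₀ ℕ) (c : ℂ) :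
    gaussPairing N (MvPolynomial.monomial s c) =
      c * if ∀ a, s (Sum.inl a) = s (Sum.inr a) then
        ∏ a, ((s (Sum.inl a)).factorial : ℂ) else 0 := by
  have h : MvPolynomial.monomial s c = c • MvPolynomial.basisMonomials (Fin N ⊕ Fin N) ℂ s := by
    rw [MvPolynomial.coe_basisMonomials, MvPolynomial.smul_monomial, smul_eq_mul, mul_one]
  rw [h, map_smul, gaussPairing, Module.Basis.constr_basis, smul_eq_mul]

/-- Integration by parts. -/
theorem gaussPairing_X_mul (a : Fin N) (F : MvPolynomial (Fin N ⊕ Fin N) ℂ) :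
    gaussPairing N (MvPolynomial.X (Sum.inl a) * F) =
      gaussPairing N (MvPolynomial.pderiv (Sum.inr a) F) := by
  induction F using MvPolynomial.induction_on' with
  | add p q hp hq => rw [mul_add, map_add, map_add, map_add, hp, hq]
  | monomial s c =>
    rw [MvPolynomial.X, MvPolynomial.monomial_mul, MvPolynomial.pderiv_monomial, one_mul,
      gaussPairing_monomial, gaussPairing_monomial]
    have e1 : ∀ b, (Finsupp.single (Sum.inl a) 1 + s : Fin N ⊕ Fin N →₀ ℕ) (Sum.inl b) =
        s (Sum.inl b) + if b = a then 1 else 0 := by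
      intro b
      by_cases h : b = a
      · subst h; simp [add_comm]
      · simp [h]
    have e2 : ∀ b, (Finsupp.single (Sum.inl a) 1 + s : Fin N ⊕ Fin N →₀ ℕ) (Sum.inr b) =
        s (Sum.inr b) := fun b => by simp
    have e3 : ∀ b, (s - Finsupp.single (Sum.inr a) 1 : Fin N ⊕ Fin N →₀ ℕ) (Sum.inl b) =
        s (Sum.inl b) := fun b => by simp
    have e4 : ∀ b, (s - Finsupp.single (Sum.inr a) 1 : Fin N ⊕ Fin N →₀ ℕ) (Sum.inr b) =
        s (Sum.inr b) - if b = a then 1 else 0 := by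
      intro b
      by_cases h : b = a
      · subst h; simp
      · simp [h]
    simp only [e1, e2, e3, e4]
    rw [mul_assoc]
    congr 1
    by_cases h0 : s (Sum.inr a) = 0
    · rw [h0, Nat.cast_zero, zero_mul, if_neg]
      intro h
      have := h a
      simp [h0] at this
    · have hiff : (∀ b, s (Sum.inl b) + (if b = a then 1 else 0) = s (Sum.inr b)) ↔
          ∀ b, s (Sum.inl b) = s (Sum.inr b) - if b = a then 1 else 0 := by
        refine forall_congr' fun b => ?_
        by_cases h : b = a
        · subst h; simp only [if_true]; omega
        · simp [h]
      by_cases h : ∀ b, s (Sum.inl b) + (if b = a then 1 else 0) = s (Sum.inr b)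
      · rw [if_pos h, if_pos (hiff.1 h), ← Finset.mul_prod_erase _ _ (Finset.mem_univ a),
          ← Finset.mul_prod_erase _ _ (Finset.mem_univ a), ← mul_assoc, ← h a]
        congr 1
        · simp [Nat.factorial_succ]
        · refine Finset.prod_congr rfl fun b hb => ?_
          rw [if_neg (Finset.ne_of_mem_erase hb), add_zero]
      · rw [if_neg h, if_neg (fun h' => h (hiff.2 h')), mul_zero]

/-- The bilinear form of a matrix in two families of variables. -/
def bilinPoly (M : Matrix (Fin N) (Fin N) ℂ) : MvPolynomial (Fin N ⊕ Fin N) ℂ :=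
  ∑ a, ∑ b, MvPolynomial.C (M a b) * (MvPolynomial.X (Sum.inl a) * MvPolynomial.X (Sum.inr b))

theorem pderiv_bilinPoly (M : Matrix (Fin N) (Fin N) ℂ) (a : Fin N) :
    MvPolynomial.pderiv (Sum.inr a) (bilinPoly M) =
      ∑ c, MvPolynomial.C (M c a) * MvPolynomial.X (Sum.inl c) := by
  rw [bilinPoly, map_sum]
  refine Finset.sum_congr rfl fun c _ => ?_
  rw [map_sum, Finset.sum_eq_single a]
  · simp
  · intro b _ hb
    simp [hb]
  · simp

theorem gaussPairing_bilinPoly_mul_pow (M M' : Matrix (Fin N) (Fin N) ℂ) (k : ℕ) :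
    gaussPairing N (bilinPoly M' * bilinPoly M ^ k) =
      M'.trace * gaussPairing N (bilinPoly M ^ k) +
        k * gaussPairing N (bilinPoly (M * M') * bilinPoly M ^ (k - 1)) := by
  have h1 : ∀ F, gaussPairing N (bilinPoly M' * F) = M'.trace * gaussPairing N F +
      gaussPairing N (∑ a, ∑ b, MvPolynomial.C (M' a b) * (MvPolynomial.X (Sum.inr b) *
        MvPolynomial.pderiv (Sum.inr a) F)) := by
    intro F
    rw [bilinPoly, Finset.sum_mul, map_sum, map_sum, Matrix.trace, Finset.sum_mul,
      ← Finset.sum_add_distrib]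
    refine Finset.sum_congr rfl fun a _ => ?_
    rw [Finset.sum_mul, map_sum, map_sum]
    have : ∀ b, gaussPairing N (MvPolynomial.C (M' a b) * (MvPolynomial.X (Sum.inl a) *
        MvPolynomial.X (Sum.inr b)) * F) = (if b = a then M' a b * gaussPairing N F else 0) +
        gaussPairing N (MvPolynomial.C (M' a b) * (MvPolynomial.X (Sum.inr b) *
        MvPolynomial.pderiv (Sum.inr a) F)) := by
      intro b
      rw [mul_assoc, mul_assoc, ← MvPolynomial.smul_eq_C_mul, ← MvPolynomial.smul_eq_C_mul,
        map_smul, map_smul, gaussPairing_X_mul, MvPolynomial.pderiv_mul, map_add, smul_add]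
      congr 1
      by_cases h : b = a
      · subst h; simp
      · rw [MvPolynomial.pderiv_X_of_ne (by simpa using h), if_neg h]
        simp
    rw [Finset.sum_congr rfl fun b _ => this b, Finset.sum_add_distrib]
    simp
  rw [h1]
  congr 1
  have h2 : (k : ℂ) * gaussPairing N (bilinPoly (M * M') * bilinPoly M ^ (k - 1)) =
      gaussPairing N ((k : MvPolynomial (Fin N ⊕ Fin N) ℂ) *
        (bilinPoly (M * M') * bilinPoly M ^ (k - 1))) := by
    rw [← smul_eq_mul, ← map_smul, MvPolynomial.smul_eq_C_mul, map_natCast]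
  rw [h2]
  congr 1
  simp_rw [Derivation.leibniz_pow, pderiv_bilinPoly, smul_eq_mul, nsmul_eq_mul]
  have h3 : bilinPoly (M * M') = ∑ a, ∑ b, ∑ c, MvPolynomial.C (M' a b) *
      (MvPolynomial.X (Sum.inr b) * (MvPolynomial.C (M c a) * MvPolynomial.X (Sum.inl c))) := by
    rw [bilinPoly]
    simp_rw [Matrix.mul_apply, map_sum, Finset.sum_mul]
    rw [Finset.sum_congr rfl fun a _ => Finset.sum_comm]
    conv_rhs => rw [Finset.sum_congr rfl fun a _ => Finset.sum_comm]
    conv_rhs => rw [Finset.sum_comm]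
    refine Finset.sum_congr rfl fun a _ => Finset.sum_congr rfl fun b _ =>
      Finset.sum_congr rfl fun c _ => ?_
    rw [map_mul]
    ring
  rw [h3]
  simp_rw [Finset.mul_sum, Finset.sum_mul, Finset.mul_sum]
  refine Finset.sum_congr rfl fun a _ => Finset.sum_congr rfl fun b _ =>
    Finset.sum_congr rfl fun c _ => ?_
  ring

/-- The complete homogeneous functions as Gaussian moments of a bilinear form. -/
theorem gaussPairing_bilinPoly_pow (M : Matrix (Fin N) (Fin N) ℂ) (k : ℕ) :
    gaussPairing N (bilinPoly M ^ k) = (k.factorial : ℂ) * hMat M k := by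
  induction k using Nat.strong_induction_on with
  | _ n ih =>
    cases n with
    | zero =>
      have h1 : (1 : MvPolynomial (Fin N ⊕ Fin N) ℂ) = MvPolynomial.monomial 0 1 := rfl
      rw [pow_zero, h1, gaussPairing_monomial]
      simp [hMat_zero]
    | succ n =>
      have key : ∀ k ≤ n, ∀ m, gaussPairing N (bilinPoly (M ^ (m + 1)) * bilinPoly M ^ k) =
          k.factorial * ∑ j ∈ Finset.range (k + 1), (M ^ (m + j + 1)).trace * hMat M (k - j) := by
        intro k
        induction k with
        | zero =>
          intro _ m
          rw [gaussPairing_bilinPoly_mul_pow, ih 0 (by omega)]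
          simp
        | succ k ihk =>
          intro hk m
          rw [gaussPairing_bilinPoly_mul_pow, ih (k + 1) (by omega), ← pow_succ',
            Nat.add_sub_cancel, ihk (by omega), Finset.sum_range_succ' _ (k + 1), Nat.factorial_succ]
          have : ∀ j, m + 1 + j + 1 = m + (j + 1) + 1 := fun j => by omega
          simp only [this, Nat.add_sub_add_right, Nat.sub_zero, add_zero]
          push_cast
          ring
      have := key n le_rfl 0
      rw [zero_add, pow_one] at this
      rw [pow_succ', this, Nat.factorial_succ, Nat.cast_mul, mul_comm ((n + 1 : ℕ) : ℂ), mul_assoc]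
      push_cast
      rw [succ_mul_hMat]
      simp

theorem eval_bilinPoly (M : Matrix (Fin N) (Fin N) ℂ) (w : Fin N ⊕ Fin N → ℂ) :
    MvPolynomial.eval w (bilinPoly M) =
      (fun a => w (Sum.inl a)) ⬝ᵥ M *ᵥ fun b => w (Sum.inr b) := by
  simp only [bilinPoly, map_sum, map_mul, MvPolynomial.eval_C, MvPolynomial.eval_X, dotProduct,
    Matrix.mulVec, Finset.mul_sum]
  exact Finset.sum_congr rfl fun a _ => Finset.sum_congr rfl fun b _ => by ring

theorem isHomogeneous_bilinPoly (M : Matrix (Fin N) (Fin N) ℂ) : (bilinPoly M).IsHomogeneous 2 := by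
  refine MvPolynomial.IsHomogeneous.sum _ _ _ fun a _ => MvPolynomial.IsHomogeneous.sum _ _ _
    fun b _ => ?_
  have := ((MvPolynomial.isHomogeneous_X ℂ (Sum.inl a : Fin N ⊕ Fin N)).mul
    (MvPolynomial.isHomogeneous_X ℂ (Sum.inr b : Fin N ⊕ Fin N))).C_mul (M a b)
  simpa using this

theorem bilinPoly_pow_eq_sum (M : Matrix (Fin N) (Fin N) ℂ) (k : ℕ) :
    bilinPoly M ^ k = ∑ s ∈ Finset.finsuppAntidiag Finset.univ (2 * k),
      MvPolynomial.monomial s (MvPolynomial.coeff s (bilinPoly M ^ k)) := by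
  conv_lhs => rw [MvPolynomial.as_sum (bilinPoly M ^ k)]
  refine Finset.sum_subset (fun s hs => ?_) fun s _ hs => ?_
  · have h := ((isHomogeneous_bilinPoly M).pow k) (MvPolynomial.mem_support_iff.1 hs)
    rw [Finset.mem_finsuppAntidiag]
    refine ⟨?_, Finset.subset_univ _⟩
    rw [← h]
    simp [Finsupp.weight_apply, Finsupp.sum_fintype]
  · rw [MvPolynomial.notMem_support_iff.1 hs, map_zero]

/-- A subspace of functions containing the powers of all bilinear forms evaluated at a matrix
valued function contains its complete homogeneous functions. -/
theorem mul_hMat_mem {α : Type*} (W : Submodule ℂ (α → ℂ)) (G : α → ℂ)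
    (φ : α → Matrix (Fin N) (Fin N) ℂ) (k : ℕ)
    (h : ∀ y z : Fin N → ℂ, (fun x => G x * (y ⬝ᵥ φ x *ᵥ z) ^ k) ∈ W) :
    (fun x => G x * hMat (φ x) k) ∈ W := by
  set S := Finset.finsuppAntidiag (Finset.univ : Finset (Fin N ⊕ Fin N)) (2 * k) with hS
  set g : (Fin N ⊕ Fin N →₀ ℕ) → α → ℂ := fun s x =>
    G x * MvPolynomial.coeff s (bilinPoly (φ x) ^ k) with hg
  have hgW : ∀ s ∈ S, g s ∈ W := by
    intro s hs
    by_contra hcon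
    obtain ⟨ℓ, hℓs, hℓ⟩ := Submodule.exists_le_ker_of_notMem hcon
    apply hℓs
    have hP : ∑ t ∈ S, MvPolynomial.monomial t (ℓ (g t)) = 0 := by
      refine MvPolynomial.funext fun w => ?_
      have h1 := hℓ (h (fun a => w (Sum.inl a)) fun b => w (Sum.inr b))
      rw [LinearMap.mem_ker] at h1
      rw [map_zero, ← h1, map_sum]
      have h2 : (fun x => G x * ((fun a => w (Sum.inl a)) ⬝ᵥ φ x *ᵥ fun b => w (Sum.inr b)) ^ k) =
          ∑ t ∈ S, (t.prod fun i e => w i ^ e) • g t := by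
        ext x
        rw [← eval_bilinPoly, ← map_pow, bilinPoly_pow_eq_sum, map_sum, Finset.mul_sum,
          Finset.sum_apply]
        refine Finset.sum_congr rfl fun t _ => ?_
        rw [MvPolynomial.eval_monomial, Pi.smul_apply, smul_eq_mul, hg]
        ring
      rw [h2, map_sum]
      refine Finset.sum_congr rfl fun t _ => ?_
      rw [MvPolynomial.eval_monomial, map_smul, smul_eq_mul, mul_comm]
    have := congrArg (MvPolynomial.coeff s) hP
    simpa [MvPolynomial.coeff_sum, MvPolynomial.coeff_monomial, hs] using this
  have : (fun x => G x * hMat (φ x) k) =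
      ∑ s ∈ S, ((k.factorial : ℂ)⁻¹ * gaussPairing N (MvPolynomial.monomial s 1)) • g s := by
    ext x
    have hk : (k.factorial : ℂ) ≠ 0 := Nat.cast_ne_zero.2 k.factorial_ne_zero
    have h1 := gaussPairing_bilinPoly_pow (φ x) k
    rw [← inv_mul_eq_iff_eq_mul₀ hk] at h1
    rw [← h1, bilinPoly_pow_eq_sum, map_sum, Finset.mul_sum, Finset.mul_sum, Finset.sum_apply]
    refine Finset.sum_congr rfl fun s _ => ?_
    rw [Pi.smul_apply, smul_eq_mul, hg, gaussPairing_monomial, gaussPairing_monomial]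
    ring
  rw [this]
  exact Submodule.sum_mem _ fun s hs => W.smul_mem _ (hgW s hs)

theorem prod_hMat_mem {α : Type*} (W : Submodule ℂ (α → ℂ))
    (φ : α → Matrix (Fin N) (Fin N) ℂ) {ι : Type*} (s : Finset ι) (ν : ι → ℕ) (G : α → ℂ)
    (h : ∀ y z : ι → Fin N → ℂ, (fun x => G x * ∏ i ∈ s, (y i ⬝ᵥ φ x *ᵥ z i) ^ ν i) ∈ W) :
    (fun x => G x * ∏ i ∈ s, hMat (φ x) (ν i)) ∈ W := by
  induction s using Finset.induction_on generalizing G with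
  | empty => simpa using h 0 0
  | insert i s hi ih =>
    simp_rw [Finset.prod_insert hi, ← mul_assoc]
    refine ih _ fun y z => ?_
    have : (fun x => G x * hMat (φ x) (ν i) * ∏ j ∈ s, (y j ⬝ᵥ φ x *ᵥ z j) ^ ν j) =
        fun x => (G x * ∏ j ∈ s, (y j ⬝ᵥ φ x *ᵥ z j) ^ ν j) * hMat (φ x) (ν i) := by
      ext x; ring
    rw [this]
    refine mul_hMat_mem W _ φ (ν i) fun y' z' => ?_
    have h' := h (Function.update y i y') (Function.update z i z')
    convert h' using 2 with x
    rw [Finset.prod_insert hi, Function.update_self, Function.update_self]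
    have : ∏ j ∈ s, (y j ⬝ᵥ φ x *ᵥ z j) ^ ν j = ∏ j ∈ s,
        (Function.update y i y' j ⬝ᵥ φ x *ᵥ Function.update z i z' j) ^ ν j := by
      refine Finset.prod_congr rfl fun j hj => ?_
      have hne : j ≠ i := fun e => hi (e ▸ hj)
      rw [Function.update_of_ne hne, Function.update_of_ne hne]
    rw [this]
    ring

/-- A mixed monomial against the density of a centered complex Gaussian. -/
def gaussMonomial (c : ℝ) (a b : ℕ) (z : ℂ) : ℂ :=
  ((c / Real.pi * Real.exp (-c * Complex.normSq z) : ℝ) : ℂ) * (z ^ a * (starRingEnd ℂ z) ^ b)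

theorem integral_norm_pow_mul_exp {c : ℝ} (hc : 0 < c) (n : ℕ) :
    ∫ z : ℂ, ‖z‖ ^ n * Real.exp (-c * Complex.normSq z) =
      Real.pi * c ^ (-((n : ℝ) + 2) / 2) * Real.Gamma (((n : ℝ) + 2) / 2) := by
  have h := Complex.integral_rpow_mul_exp_neg_mul_rpow (p := 2) (q := n) one_le_two
    (by have : (0 : ℝ) ≤ n := n.cast_nonneg
        linarith) hc
  rw [mul_div_cancel_left₀ _ (two_ne_zero' ℝ)] at h
  rw [← h]
  refine integral_congr_ae (Filter.Eventually.of_forall fun z => ?_)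
  simp [Complex.normSq_eq_norm_sq]

theorem integrable_gaussMonomial {c : ℝ} (hc : 0 < c) (a b : ℕ) :
    Integrable (gaussMonomial c a b) := by
  have h1 : Integrable fun z : ℂ => ‖z‖ ^ (a + b) * Real.exp (-c * Complex.normSq z) := by
    by_contra hcon
    have h := integral_norm_pow_mul_exp hc (a + b)
    rw [integral_undef hcon] at h
    have hpos : 0 < Real.pi * c ^ (-(((a + b : ℕ) : ℝ) + 2) / 2) *
        Real.Gamma ((((a + b : ℕ) : ℝ) + 2) / 2) :=
      mul_pos (mul_pos Real.pi_pos (Real.rpow_pos_of_pos hc _))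
        (Real.Gamma_pos_of_pos (by positivity))
    exact hpos.ne h
  refine (h1.const_mul (c / Real.pi)).mono' ?_ (Filter.Eventually.of_forall fun z => ?_)
  · refine Continuous.aestronglyMeasurable ?_
    have := Complex.continuous_normSq
    have := Complex.continuous_conj
    unfold gaussMonomial
    fun_prop
  · rw [gaussMonomial, norm_mul, norm_mul, norm_pow, norm_pow, RCLike.norm_conj,
      Complex.norm_real, Real.norm_of_nonneg (by positivity), pow_add]
    exact le_of_eq (by ring)

theorem integral_gaussMonomial {c : ℝ} (hc : 0 < c) (a b : ℕ) :
    ∫ z, gaussMonomial c a b z = if a = b then (a.factorial : ℂ) / (c : ℂ) ^ a else 0 := by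
  split_ifs with hab
  · subst hab
    have h1 : ∀ z, gaussMonomial c a a z =
        ((c / Real.pi * (‖z‖ ^ (2 * a) * Real.exp (-c * Complex.normSq z)) : ℝ) : ℂ) := by
      intro z
      rw [gaussMonomial, ← mul_pow, Complex.mul_conj, Complex.normSq_eq_norm_sq, pow_mul]
      push_cast
      ring
    simp_rw [h1]
    rw [integral_complex_ofReal, integral_const_mul, integral_norm_pow_mul_exp hc]
    have h2 : ((2 * a : ℕ) + 2 : ℝ) / 2 = a + 1 := by
      push_cast
      ring
    rw [neg_div, h2, Real.Gamma_nat_eq_factorial, Real.rpow_neg hc.le]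
    have h3 : c ^ ((a : ℝ) + 1) = c ^ (a + 1) := by
      rw [← Real.rpow_natCast]
      push_cast
      rfl
    rw [h3]
    have hpi : (Real.pi : ℂ) ≠ 0 := Complex.ofReal_ne_zero.2 Real.pi_ne_zero
    have hc' : (c : ℂ) ≠ 0 := Complex.ofReal_ne_zero.2 hc.ne'
    push_cast
    field_simp
    ring
  · set θ : ℝ := Real.pi / ((a : ℝ) - b) with hθ
    have hab' : (a : ℝ) - b ≠ 0 := sub_ne_zero.2 (Nat.cast_injective.ne hab)
    have hu : ((Circle.exp θ : ℂ)) ^ a * (starRingEnd ℂ (Circle.exp θ : ℂ)) ^ b = -1 := by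
      rw [Circle.coe_exp, ← Complex.exp_conj, ← Complex.exp_nat_mul, ← Complex.exp_nat_mul,
        ← Complex.exp_add, ← Complex.exp_pi_mul_I]
      congr 1
      have : (Real.pi : ℂ) = ((a : ℂ) - b) * θ := by
        rw [hθ]
        push_cast
        rw [mul_div_cancel₀]
        exact_mod_cast hab'
      rw [this]
      simp
      ring
    have h := (rotation (Circle.exp θ)).measurePreserving.integral_comp
      (rotation (Circle.exp θ)).toHomeomorph.measurableEmbedding (gaussMonomial c a b)
    have h2 : ∀ z, gaussMonomial c a b (rotation (Circle.exp θ) z) = -gaussMonomial c a b z := by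
      intro z
      simp only [rotation_apply, gaussMonomial, map_mul, mul_pow, Circle.normSq_coe, one_mul]
      rw [mul_mul_mul_comm (_ ^ a), hu]
      ring
    simp_rw [h2] at h
    rw [integral_neg] at h
    exact self_eq_neg.1 h.symm

/-- The monomial in the matrix entries with the given exponents. -/
def matMonomial (α : Fin N × Fin N → ℕ) (X : Matrix (Fin N) (Fin N) ℂ) : ℂ :=
  ∏ p, X p.1 p.2 ^ α p

theorem density_smul_matMonomial (α β : Fin N × Fin N → ℕ) (X : Matrix (Fin N) (Fin N) ℂ) :
    (ENNReal.ofReal (((N : ℝ) / Real.pi) ^ (N ^ 2) *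
      Real.exp (-(N : ℝ) * ∑ i, ∑ j, Complex.normSq (X i j)))).toReal •
      (matMonomial α X * starRingEnd ℂ (matMonomial β X)) =
      ∏ i, ∏ j, gaussMonomial N (α (i, j)) (β (i, j)) (X i j) := by
  rw [ENNReal.toReal_ofReal (by positivity)]
  simp_rw [gaussMonomial, Finset.prod_mul_distrib, matMonomial, Fintype.prod_prod_type, map_prod,
    map_pow]
  rw [Complex.real_smul]
  congr 1
  push_cast
  simp_rw [Finset.prod_mul_distrib, ← Complex.exp_sum, ← Finset.mul_sum]
  simp [sq, pow_mul, div_pow]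

theorem measurable_density (N : ℕ) : Measurable fun X : Matrix (Fin N) (Fin N) ℂ =>
    ENNReal.ofReal (((N : ℝ) / Real.pi) ^ (N ^ 2) *
      Real.exp (-(N : ℝ) * ∑ i, ∑ j, Complex.normSq (X i j))) := by
  refine ENNReal.measurable_ofReal.comp ?_
  have h : ∀ i j, Measurable fun X : Fin N → Fin N → ℂ => Complex.normSq (X i j) := by
    intro i j
    exact Complex.continuous_normSq.measurable.comp
      ((measurable_pi_apply j).comp (measurable_pi_apply i))
  have h2 : Measurable fun X : Fin N → Fin N → ℂ => ∑ i, ∑ j, Complex.normSq (X i j) :=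
    Finset.measurable_sum _ fun i _ => Finset.measurable_sum _ fun j _ => h i j
  exact (Real.measurable_exp.comp (h2.const_mul _)).const_mul _

theorem integrable_matMonomial (hN : 1 ≤ N) (α β : Fin N × Fin N → ℕ) :
    Integrable (fun X => matMonomial α X * starRingEnd ℂ (matMonomial β X))
      (gaussianMatrix N) := by
  rw [gaussianMatrix, integrable_withDensity_iff_integrable_smul' (measurable_density N)
    (Filter.Eventually.of_forall fun _ => ENNReal.ofReal_lt_top)]
  simp_rw [density_smul_matMonomial]
  have hN' : (0 : ℝ) < N := by exact_mod_cast hN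
  exact Integrable.fintype_prod_dep (E := fun _ : Fin N => Fin N → ℂ)
    (f := fun i (x : Fin N → ℂ) => ∏ j, gaussMonomial N (α (i, j)) (β (i, j)) (x j))
    fun i => Integrable.fintype_prod_dep fun j => integrable_gaussMonomial hN' _ _

theorem integral_matMonomial (hN : 1 ≤ N) (α β : Fin N × Fin N → ℕ) :
    ∫ X, matMonomial α X * starRingEnd ℂ (matMonomial β X) ∂(gaussianMatrix N) =
      if α = β then (∏ p, ((α p).factorial : ℂ)) / (N : ℂ) ^ (∑ p, α p) else 0 := by
  rw [gaussianMatrix, integral_withDensity_eq_integral_toReal_smul (measurable_density N)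
    (Filter.Eventually.of_forall fun _ => ENNReal.ofReal_lt_top)]
  simp_rw [density_smul_matMonomial]
  have hN' : (0 : ℝ) < N := by exact_mod_cast hN
  have h : ∫ X : Matrix (Fin N) (Fin N) ℂ,
      ∏ i, ∏ j, gaussMonomial N (α (i, j)) (β (i, j)) (X i j) =
      ∏ i, ∏ j, ∫ z, gaussMonomial N (α (i, j)) (β (i, j)) z := by
    refine (integral_fintype_prod_volume_eq_prod (E := fun _ : Fin N => Fin N → ℂ)
      fun i (x : Fin N → ℂ) => ∏ j, gaussMonomial N (α (i, j)) (β (i, j)) (x j)).trans ?_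
    exact Finset.prod_congr rfl fun i _ => integral_fintype_prod_volume_eq_prod _
  rw [h]
  simp_rw [integral_gaussMonomial hN']
  rw [← Fintype.prod_prod_type fun p : Fin N × Fin N =>
    if α p = β p then ((α p).factorial : ℂ) / ((N : ℝ) : ℂ) ^ α p else 0]
  split_ifs with hab
  · subst hab
    simp [Finset.prod_div_distrib, Finset.prod_pow_eq_pow_sum]
  · obtain ⟨p, hp⟩ := Function.ne_iff.1 hab
    exact Finset.prod_eq_zero (Finset.mem_univ p) (if_neg hp)

/-- The functions on matrices that are homogeneous polynomials of degree `d` in the entries. -/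
def homPoly (N d : ℕ) : Submodule ℂ (Matrix (Fin N) (Fin N) ℂ → ℂ) :=
  Submodule.span ℂ {f | ∃ α : Fin N × Fin N → ℕ, ∑ p, α p = d ∧ f = matMonomial α}

theorem matMonomial_add (α β : Fin N × Fin N → ℕ) :
    matMonomial (α + β) = matMonomial α * matMonomial β := by
  ext X
  simp [matMonomial, pow_add, Finset.prod_mul_distrib]

theorem mul_mem_homPoly {d e : ℕ} {f g : Matrix (Fin N) (Fin N) ℂ → ℂ} (hf : f ∈ homPoly N d)
    (hg : g ∈ homPoly N e) : (fun X => f X * g X) ∈ homPoly N (d + e) := by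
  have h := Submodule.mul_mem_mul hf hg
  rw [homPoly, homPoly, Submodule.span_mul_span] at h
  refine Submodule.span_mono ?_ h
  rintro _ ⟨_, ⟨α, hα, rfl⟩, _, ⟨β, hβ, rfl⟩, rfl⟩
  exact ⟨α + β, by simp [Finset.sum_add_distrib, hα, hβ], (matMonomial_add α β).symm⟩

theorem one_mem_homPoly : (fun _ => 1) ∈ homPoly N 0 :=
  Submodule.subset_span ⟨0, by simp, by ext X; simp [matMonomial]⟩

theorem const_mul_mem_homPoly {d : ℕ} (c : ℂ) {f : Matrix (Fin N) (Fin N) ℂ → ℂ}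
    (hf : f ∈ homPoly N d) : (fun X => c * f X) ∈ homPoly N d :=
  (homPoly N d).smul_mem c hf

theorem sum_mem_homPoly {d : ℕ} {ι : Type*} (s : Finset ι)
    {f : ι → Matrix (Fin N) (Fin N) ℂ → ℂ} (hf : ∀ i ∈ s, f i ∈ homPoly N d) :
    (fun X => ∑ i ∈ s, f i X) ∈ homPoly N d := by
  convert Submodule.sum_mem _ hf using 1
  ext X
  simp

theorem const_mem_homPoly (c : ℂ) : (fun _ => c) ∈ homPoly N 0 := by
  simpa using const_mul_mem_homPoly c one_mem_homPoly

theorem prod_mem_homPoly {ι : Type*} (s : Finset ι) {d : ι → ℕ}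
    {f : ι → Matrix (Fin N) (Fin N) ℂ → ℂ} (hf : ∀ i ∈ s, f i ∈ homPoly N (d i)) :
    (fun X => ∏ i ∈ s, f i X) ∈ homPoly N (∑ i ∈ s, d i) := by
  induction s using Finset.induction_on with
  | empty => simpa using one_mem_homPoly
  | insert i s hi ih =>
    simp_rw [Finset.prod_insert hi, Finset.sum_insert hi]
    exact mul_mem_homPoly (hf i (Finset.mem_insert_self i s))
      (ih fun j hj => hf j (Finset.mem_insert_of_mem hj))

theorem list_prod_mem_homPoly (c : List ℕ) {f : ℕ → Matrix (Fin N) (Fin N) ℂ → ℂ}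
    (hf : ∀ r, f r ∈ homPoly N r) : (fun X => (c.map fun r => f r X).prod) ∈ homPoly N c.sum := by
  induction c with
  | nil => simpa using one_mem_homPoly
  | cons r c ih =>
    simp_rw [List.map_cons, List.prod_cons, List.sum_cons]
    exact mul_mem_homPoly (hf r) ih

theorem pow_mem_homPoly {d : ℕ} {f : Matrix (Fin N) (Fin N) ℂ → ℂ} (hf : f ∈ homPoly N d) (n : ℕ) :
    (fun X => f X ^ n) ∈ homPoly N (n * d) := by
  simpa using prod_mem_homPoly (Finset.range n) (d := fun _ => d) (f := fun _ => f) fun _ _ => hf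

theorem entry_mem_homPoly (i j : Fin N) : (fun X => X i j) ∈ homPoly N 1 := by
  refine Submodule.subset_span ⟨Pi.single (i, j) 1, by simp, ?_⟩
  ext X
  rw [matMonomial, Finset.prod_eq_single (i, j)]
  · simp
  · intro p _ hp
    simp [hp]
  · simp

theorem entry_mul_mem_homPoly (B : Matrix (Fin N) (Fin N) ℂ) (i j : Fin N) :
    (fun X => (X * B) i j) ∈ homPoly N 1 := by
  simp_rw [Matrix.mul_apply, mul_comm _ (B _ _)]
  exact sum_mem_homPoly _ fun k _ => const_mul_mem_homPoly _ (entry_mem_homPoly i k)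

theorem entry_pow_mem_homPoly (B : Matrix (Fin N) (Fin N) ℂ) (m : ℕ) (i j : Fin N) :
    (fun X => ((X * B) ^ m) i j) ∈ homPoly N m := by
  induction m generalizing i j with
  | zero => simpa using const_mem_homPoly ((1 : Matrix (Fin N) (Fin N) ℂ) i j)
  | succ m ih =>
    simp_rw [pow_succ, Matrix.mul_apply (M := (_ * B) ^ m)]
    exact sum_mem_homPoly _ fun k _ => mul_mem_homPoly (ih i k) (entry_mul_mem_homPoly B k j)

theorem hMat_mem_homPoly (B : Matrix (Fin N) (Fin N) ℂ) (k : ℕ) :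
    (fun X => hMat (X * B) k) ∈ homPoly N k := by
  induction k using Nat.strong_induction_on with
  | _ n ih =>
    cases n with
    | zero => simpa [hMat_zero] using one_mem_homPoly
    | succ n =>
      simp_rw [hMat]
      refine const_mul_mem_homPoly _ (sum_mem_homPoly _ fun m hm => ?_)
      have hm' : m + 1 + (n - m) = n + 1 := by
        have := Finset.mem_range.1 hm
        omega
      rw [← hm']
      refine mul_mem_homPoly ?_ (ih _ (by omega))
      exact sum_mem_homPoly _ fun i _ => entry_pow_mem_homPoly B (m + 1) i i

theorem schur_mem_homPoly (B : Matrix (Fin N) (Fin N) ℂ) (l : Fin N → ℕ) :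
    (fun X => schur l (X * B)) ∈ homPoly N (wt l) := by
  simp_rw [schur, Matrix.det_apply', Matrix.of_apply]
  refine sum_mem_homPoly _ fun σ _ => const_mul_mem_homPoly _ ?_
  by_cases h : ∀ i, 0 ≤ (l (σ i) : ℤ) - (σ i : ℕ) + i
  · have h1 : wt l = ∑ i, ((l (σ i) : ℤ) - (σ i : ℕ) + i).toNat := by
      rw [wt]
      zify
      simp_rw [Int.toNat_of_nonneg (h _)]
      rw [Finset.sum_add_distrib, Finset.sum_sub_distrib, Equiv.sum_comp σ fun i => (l i : ℤ),
        Equiv.sum_comp σ fun i => ((i : ℕ) : ℤ)]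
      ring
    rw [h1]
    refine prod_mem_homPoly _ fun i _ => ?_
    simp_rw [hMatZ, if_neg (not_lt.2 (h i))]
    exact hMat_mem_homPoly B _
  · push Not at h
    obtain ⟨i, hi⟩ := h
    have : (fun X : Matrix (Fin N) (Fin N) ℂ =>
        ∏ i, hMatZ (X * B) ((l (σ i) : ℤ) - (σ i : ℕ) + i)) = 0 := by
      ext X
      exact Finset.prod_eq_zero (Finset.mem_univ i) (hMatZ_of_neg _ hi)
    rw [this]
    exact Submodule.zero_mem _

theorem eMat_mem_homPoly (B : Matrix (Fin N) (Fin N) ℂ) (k : ℕ) :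
    (fun X => eMat k (X * B)) ∈ homPoly N k := by
  simp_rw [eMat, Matrix.det_apply', Matrix.of_apply]
  refine sum_mem_homPoly _ fun S hS => sum_mem_homPoly _ fun σ _ => const_mul_mem_homPoly _ ?_
  have h1 : k = ∑ i, if σ i ∈ S then 1 else 0 := by
    rw [Equiv.sum_comp σ fun i => if i ∈ S then 1 else 0]
    simp [(Finset.mem_powersetCard.1 hS).2]
  rw [h1]
  refine prod_mem_homPoly _ fun i _ => ?_
  by_cases h : σ i ∈ S
  · simp_rw [if_pos h]
    exact entry_mul_mem_homPoly B _ _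
  · simp_rw [if_neg h]
    exact const_mem_homPoly _

theorem matMonomial_conjTranspose (β : Fin N × Fin N → ℕ) (X : Matrix (Fin N) (Fin N) ℂ) :
    matMonomial β Xᴴ = starRingEnd ℂ (matMonomial (fun p => β p.swap) X) := by
  rw [matMonomial, matMonomial, map_prod]
  simp_rw [map_pow, Matrix.conjTranspose_apply]
  exact (Equiv.prod_comp (Equiv.prodComm (Fin N) (Fin N)) fun p =>
    (star (X p.2 p.1)) ^ β p).symm

theorem integrable_homPoly (hN : 1 ≤ N) {n d : ℕ} {f g : Matrix (Fin N) (Fin N) ℂ → ℂ}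
    (hf : f ∈ homPoly N n) (hg : g ∈ homPoly N d) :
    Integrable (fun X => f X * g Xᴴ) (gaussianMatrix N) := by
  induction hf using Submodule.span_induction with
  | mem f hf =>
    obtain ⟨α, -, rfl⟩ := hf
    induction hg using Submodule.span_induction with
    | mem g hg =>
      obtain ⟨β, -, rfl⟩ := hg
      simp_rw [matMonomial_conjTranspose]
      exact integrable_matMonomial hN _ _
    | zero => simp
    | add g g' _ _ h h' =>
      simp_rw [Pi.add_apply, mul_add]
      exact h.add h'
    | smul c g _ h => simpa [mul_left_comm] using h.const_mul c
  | zero => simp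
  | add g g' _ _ h h' =>
    simp_rw [Pi.add_apply, add_mul]
    exact h.add h'
  | smul c g _ h => simpa [mul_assoc] using h.const_mul c

theorem trace_mul_pow_eq_sum (A X : Matrix (Fin N) (Fin N) ℂ) (n : ℕ) :
    (X * A).trace ^ n = ∑ k ∈ Finset.piAntidiag (Finset.univ : Finset (Fin N × Fin N)) n,
      (Nat.multinomial Finset.univ k : ℂ) * matMonomial (fun p => k p.swap) A *
        matMonomial k X := by
  have h : (X * A).trace = ∑ p : Fin N × Fin N, X p.1 p.2 * A p.2 p.1 := by
    simp [Matrix.trace, Matrix.mul_apply, Fintype.sum_prod_type]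
  rw [h, Finset.sum_pow_eq_sum_piAntidiag]
  refine Finset.sum_congr rfl fun k _ => ?_
  have h2 : matMonomial (fun p => k p.swap) A = ∏ p : Fin N × Fin N, A p.2 p.1 ^ k p :=
    Equiv.prod_comp (Equiv.prodComm (Fin N) (Fin N)) fun p => (A p.2 p.1) ^ k p
  rw [h2, matMonomial]
  simp_rw [mul_pow, Finset.prod_mul_distrib]
  ring

/-- The reproducing property of the powers of `X ↦ Tr (X A)` for the Gaussian pairing. -/
theorem integral_trace_pow_mul (hN : 1 ≤ N) (A : Matrix (Fin N) (Fin N) ℂ) (n : ℕ) {d : ℕ}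
    {f : Matrix (Fin N) (Fin N) ℂ → ℂ} (hf : f ∈ homPoly N d) :
    ∫ X, (X * A).trace ^ n * f Xᴴ ∂(gaussianMatrix N) =
      if n = d then (n.factorial : ℂ) / (N : ℂ) ^ n * f A else 0 := by
  have htr : (fun X : Matrix (Fin N) (Fin N) ℂ => (X * A).trace ^ n) ∈ homPoly N n := by
    have h : (fun X : Matrix (Fin N) (Fin N) ℂ => (X * A).trace) ∈ homPoly N 1 :=
      sum_mem_homPoly _ fun i _ => entry_mul_mem_homPoly A i i
    simpa using pow_mem_homPoly h n
  induction hf using Submodule.span_induction with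
  | mem f hf =>
    obtain ⟨β, hβ, rfl⟩ := hf
    simp_rw [trace_mul_pow_eq_sum, Finset.sum_mul, matMonomial_conjTranspose, mul_assoc]
    rw [integral_finsetSum _ fun k _ =>
      ((integrable_matMonomial hN _ _).const_mul _).const_mul _]
    simp_rw [integral_const_mul, integral_matMonomial hN]
    have hsw : ∑ p : Fin N × Fin N, β p.swap = d := by
      rw [← hβ]
      exact Equiv.sum_comp (Equiv.prodComm (Fin N) (Fin N)) β
    have hmem : (fun p : Fin N × Fin N => β p.swap) ∈ Finset.piAntidiag Finset.univ n ↔ n = d := by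
      rw [Finset.mem_piAntidiag, hsw]
      simp [eq_comm]
    have h2 : ∀ k : Fin N × Fin N → ℕ, k ≠ (fun p => β p.swap) →
        (Nat.multinomial Finset.univ k : ℂ) * (matMonomial (fun p => k p.swap) A *
          if k = fun p => β p.swap then (∏ p, ((k p).factorial : ℂ)) / (N : ℂ) ^ (∑ p, k p)
            else 0) = 0 := by
      intro k hk
      rw [if_neg hk, mul_zero, mul_zero]
    split_ifs with hnd
    · rw [Finset.sum_eq_single _ (fun k _ hk => h2 k hk) fun h => absurd (hmem.2 hnd) h, if_pos rfl,
        hsw, hnd]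
      have h3 := Nat.multinomial_spec Finset.univ fun p : Fin N × Fin N => β p.swap
      rw [hsw] at h3
      rw [← h3]
      push_cast
      simp only [Prod.swap_swap]
      ring
    · exact Finset.sum_eq_zero fun k hk => h2 k fun h => hnd (hmem.1 (h ▸ hk))
  | zero => simp
  | add g g' hg hg' h h' =>
    simp_rw [Pi.add_apply, mul_add]
    rw [integral_add (integrable_homPoly hN htr hg) (integrable_homPoly hN htr hg'), h, h']
    split_ifs <;> simp
  | smul c g _ h =>
    simp_rw [Pi.smul_apply, smul_eq_mul, mul_left_comm _ c]
    rw [integral_const_mul, h]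
    split_ifs <;> simp

theorem partSum_le_of_coeff_ne_zero (D : Finset (Fin N) → ℂ) (c : List ℕ) (ν : Fin N →₀ ℕ)
    (h : MvPolynomial.coeff ν (c.map fun r => ∑ S ∈ Finset.powersetCard r Finset.univ,
      MvPolynomial.monomial (∑ i ∈ S, Finsupp.single i 1) (D S)).prod ≠ 0) (k : ℕ) :
    partSum ν k ≤ (c.map (min k)).sum := by
  induction c generalizing ν with
  | nil =>
    rw [List.map_nil, List.prod_nil, MvPolynomial.coeff_one] at h
    have : ν = 0 := by
      by_contra hne
      exact h (if_neg (Ne.symm hne))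
    subst this
    simp [partSum]
  | cons r c ih =>
    rw [List.map_cons, List.prod_cons, MvPolynomial.coeff_mul] at h
    obtain ⟨⟨a, b⟩, hab, hne⟩ := Finset.exists_ne_zero_of_sum_ne_zero h
    rw [Finset.HasAntidiagonal.mem_antidiagonal] at hab
    obtain ⟨h1, h2⟩ := mul_ne_zero_iff.1 hne
    rw [MvPolynomial.coeff_sum] at h1
    obtain ⟨S, hS, hS1⟩ := Finset.exists_ne_zero_of_sum_ne_zero h1
    rw [MvPolynomial.coeff_monomial] at hS1
    have ha : ∑ i ∈ S, Finsupp.single i 1 = a := by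
      by_contra hcon
      exact hS1 (if_neg hcon)
    have hν : (ν : Fin N → ℕ) = fun i => (if i ∈ S then 1 else 0) + b i := by
      ext i
      rw [← hab, ← ha]
      simp [Finsupp.single_apply]
    rw [hν, partSum_add, List.map_cons, List.sum_cons]
    refine add_le_add ?_ (ih b h2)
    rw [← (Finset.mem_powersetCard.1 hS).2]
    exact partSum_indicator_le S k

theorem bilin_mem_homPoly (A : Matrix (Fin N) (Fin N) ℂ) (y z : Fin N → ℂ) :
    (fun X : Matrix (Fin N) (Fin N) ℂ => y ⬝ᵥ (X * A) *ᵥ z) ∈ homPoly N 1 := by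
  simp_rw [dotProduct, Matrix.mulVec, dotProduct]
  refine sum_mem_homPoly _ fun a _ => const_mul_mem_homPoly _ (sum_mem_homPoly _ fun b _ => ?_)
  simp_rw [mul_comm _ (z b)]
  exact const_mul_mem_homPoly _ (entry_mul_mem_homPoly A a b)

theorem prod_bilin_pow_mem_homPoly (A : Matrix (Fin N) (Fin N) ℂ) (y z : Fin N → Fin N → ℂ)
    (ν : Fin N → ℕ) :
    (fun X : Matrix (Fin N) (Fin N) ℂ => ∏ i, (y i ⬝ᵥ (X * A) *ᵥ z i) ^ ν i) ∈
      homPoly N (∑ i, ν i) := by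
  refine prod_mem_homPoly _ fun i _ => ?_
  simpa using pow_mem_homPoly (bilin_mem_homPoly A (y i) (z i)) (ν i)

/-- The triangularity of the Gaussian pairing, before passing to symmetric functions. -/
theorem integral_prod_bilin_pow_mul_eq_zero (hN : 1 ≤ N) (A B : Matrix (Fin N) (Fin N) ℂ)
    (c : List ℕ) (ν : Fin N → ℕ) (hν : ¬∀ k, partSum ν k ≤ (c.map (min k)).sum)
    (y z : Fin N → Fin N → ℂ) :
    ∫ X, (∏ i, (y i ⬝ᵥ (X * A) *ᵥ z i) ^ ν i) * (c.map fun r => eMat r (Xᴴ * B)).prod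
      ∂(gaussianMatrix N) = 0 := by
  set n := ∑ i, ν i with hn
  set I : (Fin N → ℕ) → ℂ := fun k => ∫ X, (∏ i, (y i ⬝ᵥ (X * A) *ᵥ z i) ^ k i) *
    (c.map fun r => eMat r (Xᴴ * B)).prod ∂(gaussianMatrix N) with hI
  set Y : Matrix (Fin N) (Fin N) ℂ := Matrix.of y
  set Z : Matrix (Fin N) (Fin N) ℂ := (Matrix.of z)ᵀ
  set K := Y * B * A * Z with hK
  set D : Finset (Fin N) → ℂ := fun S =>
    (Matrix.of fun i => if i ∈ S then K i else (1 : Matrix (Fin N) (Fin N) ℂ) i).det with hD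
  set κ : ℂ := if n = c.sum then (n.factorial : ℂ) / (N : ℂ) ^ n else 0 with hκ
  have hQ : (fun M : Matrix (Fin N) (Fin N) ℂ => (c.map fun r => eMat r (M * B)).prod) ∈
      homPoly N c.sum := list_prod_mem_homPoly c fun r => eMat_mem_homPoly B r
  have hpoly : ∑ k ∈ Finset.piAntidiag (Finset.univ : Finset (Fin N)) n,
      MvPolynomial.monomial (Finsupp.equivFunOnFinite.symm k)
        ((Nat.multinomial Finset.univ k : ℂ) * I k) =
      MvPolynomial.C κ * (c.map fun r => ∑ S ∈ Finset.powersetCard r Finset.univ,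
        MvPolynomial.monomial (∑ i ∈ S, Finsupp.single i 1) (D S)).prod := by
    refine MvPolynomial.funext fun s => ?_
    have hR := integral_trace_pow_mul hN (A * (Z * Matrix.diagonal s * Y)) n hQ
    have htr : ∀ X : Matrix (Fin N) (Fin N) ℂ, (X * (A * (Z * Matrix.diagonal s * Y))).trace =
        ∑ i, s i * (y i ⬝ᵥ (X * A) *ᵥ z i) := by
      intro X
      have h1 : X * (A * (Z * Matrix.diagonal s * Y)) = (X * A * Z) * (Matrix.diagonal s * Y) := by
        simp only [Matrix.mul_assoc]
      rw [h1, Matrix.trace_mul_comm, Matrix.mul_assoc, Matrix.trace]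
      refine Finset.sum_congr rfl fun i _ => ?_
      rw [Matrix.diag_apply, Matrix.diagonal_mul]
      rfl
    have hL : ∫ X, (X * (A * (Z * Matrix.diagonal s * Y))).trace ^ n *
        (c.map fun r => eMat r (Xᴴ * B)).prod ∂(gaussianMatrix N) =
        ∑ k ∈ Finset.piAntidiag (Finset.univ : Finset (Fin N)) n,
          (∏ i, s i ^ k i) * ((Nat.multinomial Finset.univ k : ℂ) * I k) := by
      have h1 : ∀ X : Matrix (Fin N) (Fin N) ℂ, (X * (A * (Z * Matrix.diagonal s * Y))).trace ^ n *
          (c.map fun r => eMat r (Xᴴ * B)).prod =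
          ∑ k ∈ Finset.piAntidiag (Finset.univ : Finset (Fin N)) n,
          ((∏ i, s i ^ k i) * (Nat.multinomial Finset.univ k : ℂ)) *
            ((∏ i, (y i ⬝ᵥ (X * A) *ᵥ z i) ^ k i) *
              (c.map fun r => eMat r (Xᴴ * B)).prod) := by
        intro X
        rw [htr, Finset.sum_pow_eq_sum_piAntidiag, Finset.sum_mul]
        refine Finset.sum_congr rfl fun k _ => ?_
        simp_rw [mul_pow, Finset.prod_mul_distrib]
        ring
      simp_rw [h1]
      rw [integral_finsetSum _ fun k _ =>
        (integrable_homPoly hN (prod_bilin_pow_mem_homPoly A y z k) hQ).const_mul _]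
      refine Finset.sum_congr rfl fun k _ => ?_
      rw [integral_const_mul, mul_assoc]
    have hE : ∀ r, eMat r (A * (Z * Matrix.diagonal s * Y) * B) =
        ∑ S ∈ Finset.powersetCard r Finset.univ, (∏ i ∈ S, s i) * D S := by
      intro r
      have h1 : A * (Z * Matrix.diagonal s * Y) * B =
          (A * Z) * (Matrix.diagonal s * (Y * B)) := by
        simp only [Matrix.mul_assoc]
      rw [h1, eMat_mul_comm, Matrix.mul_assoc, ← Matrix.mul_assoc (Y * B), eMat_diagonal_mul]
    have hev : ∀ S : Finset (Fin N), MvPolynomial.eval s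
        (MvPolynomial.monomial (∑ i ∈ S, Finsupp.single i 1) (D S)) = (∏ i ∈ S, s i) * D S := by
      intro S
      rw [MvPolynomial.monomial_eq, map_mul, MvPolynomial.eval_C, mul_comm]
      congr 1
      rw [Finsupp.prod_fintype _ _ fun i => pow_zero _, map_prod]
      simp_rw [map_pow, MvPolynomial.eval_X, Finsupp.coe_finsetSum, Finset.sum_apply,
        Finsupp.single_apply]
      rw [← Finset.prod_subset (Finset.subset_univ S)]
      · refine Finset.prod_congr rfl fun i hi => ?_
        simp [hi]
      · intro i _ hi
        simp [hi]
    rw [map_sum, map_mul, MvPolynomial.eval_C, map_list_prod, List.map_map]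
    simp only [Function.comp_def, map_sum, hev]
    simp_rw [hL, hE] at hR
    rw [hκ, ite_mul, zero_mul, ← hR]
    refine Finset.sum_congr rfl fun k _ => ?_
    rw [MvPolynomial.eval_monomial, Finsupp.prod_fintype _ _ fun i => pow_zero _, mul_comm]
    rfl
  have hcoeff := congrArg (MvPolynomial.coeff (Finsupp.equivFunOnFinite.symm ν)) hpoly
  rw [MvPolynomial.coeff_sum, MvPolynomial.coeff_C_mul] at hcoeff
  have hz : MvPolynomial.coeff (Finsupp.equivFunOnFinite.symm ν)
      (c.map fun r => ∑ S ∈ Finset.powersetCard r Finset.univ,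
        MvPolynomial.monomial (∑ i ∈ S, Finsupp.single i 1) (D S)).prod = 0 := by
    by_contra hcon
    exact hν fun k => partSum_le_of_coeff_ne_zero D c _ hcon k
  rw [hz, mul_zero, Finset.sum_eq_single ν] at hcoeff
  · rw [MvPolynomial.coeff_monomial, if_pos rfl] at hcoeff
    refine (mul_eq_zero.1 hcoeff).resolve_left (Nat.cast_ne_zero.2 ?_)
    exact (Nat.multinomial_pos _ _).ne'
  · intro k _ hk
    rw [MvPolynomial.coeff_monomial, if_neg]
    exact fun h => hk (Finsupp.equivFunOnFinite.symm.injective h)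
  · intro h
    exact absurd (Finset.mem_piAntidiag.2 ⟨hn.symm, fun i _ => Finset.mem_univ i⟩) h

/-- The functions whose composition with `φ` is integrable against `g` with integral zero. -/
def integralNull {α β : Type*} [MeasurableSpace α] (μ : Measure α) (φ : α → β) (g : α → ℂ) :
    Submodule ℂ (β → ℂ) where
  carrier := {f | Integrable (fun x => f (φ x) * g x) μ ∧ ∫ x, f (φ x) * g x ∂μ = 0}
  zero_mem' := by simp
  add_mem' := by
    rintro f f' ⟨h1, h2⟩ ⟨h1', h2'⟩
    simp_rw [Set.mem_ofPred_eq, Pi.add_apply, add_mul]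
    exact ⟨h1.add h1', by rw [integral_add h1 h1', h2, h2', add_zero]⟩
  smul_mem' := by
    rintro c f ⟨h1, h2⟩
    simp_rw [Set.mem_ofPred_eq, Pi.smul_apply, smul_eq_mul, mul_assoc]
    exact ⟨h1.const_mul c, by rw [integral_const_mul, h2, mul_zero]⟩

theorem integral_prod_hMat_mul_eq_zero (hN : 1 ≤ N) (A B : Matrix (Fin N) (Fin N) ℂ)
    (c : List ℕ) (ν : Fin N → ℕ) (hν : ¬∀ k, partSum ν k ≤ (c.map (min k)).sum) :
    ∫ X, (∏ i, hMat (X * A) (ν i)) * (c.map fun r => eMat r (Xᴴ * B)).prod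
      ∂(gaussianMatrix N) = 0 := by
  have h := prod_hMat_mem (integralNull (gaussianMatrix N) id
    fun X => (c.map fun r => eMat r (Xᴴ * B)).prod) (fun X => X * A) Finset.univ ν (fun _ => 1)
    fun y z => ⟨by
      have hQ : (fun M : Matrix (Fin N) (Fin N) ℂ => (c.map fun r => eMat r (M * B)).prod) ∈
        homPoly N c.sum := list_prod_mem_homPoly c fun r => eMat_mem_homPoly B r
      simpa using integrable_homPoly hN (prod_bilin_pow_mem_homPoly A y z ν) hQ, by
      simpa using integral_prod_bilin_pow_mul_eq_zero hN A B c ν hν y z⟩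
  simpa using h.2

theorem integral_prod_hMat_mul_schur_eq_zero (hN : 1 ≤ N) (A B : Matrix (Fin N) (Fin N) ℂ)
    (m : Fin N → ℕ) (hm : Antitone m) (ν : Fin N → ℕ)
    (hν : ¬∀ k, partSum ν k ≤ partSum m k) :
    ∫ X, (∏ i, hMat (X * A) (ν i)) * schur m (Xᴴ * B) ∂(gaussianMatrix N) = 0 := by
  have h : eSpan m ≤ integralNull (gaussianMatrix N) (fun X => Xᴴ * B)
      fun X => ∏ i, hMat (X * A) (ν i) := by
    refine Submodule.span_le.2 ?_
    rintro _ ⟨c, hc, rfl⟩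
    have hP : (fun X : Matrix (Fin N) (Fin N) ℂ => ∏ i, hMat (X * A) (ν i)) ∈
        homPoly N (∑ i, ν i) := prod_mem_homPoly Finset.univ fun i _ => hMat_mem_homPoly A (ν i)
    have hQ : (fun M : Matrix (Fin N) (Fin N) ℂ => (c.map fun r => eMat r (M * B)).prod) ∈
        homPoly N c.sum := list_prod_mem_homPoly c fun r => eMat_mem_homPoly B r
    have h1 := integrable_homPoly hN hP hQ
    have h2 := integral_prod_hMat_mul_eq_zero hN A B c ν fun hcon =>
      hν fun k => (hcon k).trans (hc k)
    exact ⟨h1.congr (ae_of_all _ fun X => mul_comm _ _),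
      (integral_congr_ae (ae_of_all _ fun X => mul_comm _ _)).trans h2⟩
  exact (integral_congr_ae (ae_of_all _ fun X => mul_comm _ _)).trans
    (h (schur_mem_eSpan m hm)).2

theorem integrable_schur_mul_schur (hN : 1 ≤ N) (A B : Matrix (Fin N) (Fin N) ℂ)
    (l m : Fin N → ℕ) :
    Integrable (fun X => schur l (X * A) * schur m (Xᴴ * B)) (gaussianMatrix N) :=
  integrable_homPoly hN (f := fun X => schur l (X * A)) (g := fun X => schur m (X * B))
    (schur_mem_homPoly A l) (schur_mem_homPoly B m)

theorem partSum_val_le_partSum_perm (σ : Equiv.Perm (Fin N)) (k : ℕ) :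
    partSum (fun i : Fin N => (i : ℕ)) k ≤ partSum (fun i : Fin N => (σ i : ℕ)) k := by
  have h : Antivary (fun i : Fin N => if (i : ℕ) < k then (1 : ℤ) else 0)
      fun i : Fin N => ((i : ℕ) : ℤ) := by
    intro i j hij
    have : (i : ℕ) < j := by
      have h : ((i : ℕ) : ℤ) < ((j : ℕ) : ℤ) := hij
      exact_mod_cast h
    simp only
    split_ifs <;> omega
  have h2 := h.sum_mul_le_sum_mul_comp_perm (σ := σ)
  simp only [ite_mul, one_mul, zero_mul] at h2
  rw [partSum, partSum]
  exact_mod_cast h2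

/-- The triangularity of the Gaussian pairing of Schur polynomials in the dominance order. -/
theorem integral_schur_mul_schur_eq_zero_of_not_le (hN : 1 ≤ N)
    (A B : Matrix (Fin N) (Fin N) ℂ) (l m : Fin N → ℕ) (hm : Antitone m)
    (h : ¬∀ k, partSum l k ≤ partSum m k) :
    ∫ X, schur l (X * A) * schur m (Xᴴ * B) ∂(gaussianMatrix N) = 0 := by
  set W := integralNull (gaussianMatrix N) id fun X => schur m (Xᴴ * B) with hW
  suffices hmem : (fun X => schur l (X * A)) ∈ W from hmem.2
  have hs : (fun X : Matrix (Fin N) (Fin N) ℂ => schur l (X * A)) =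
      ∑ σ : Equiv.Perm (Fin N), ((Equiv.Perm.sign σ : ℤ) : ℂ) •
        fun X : Matrix (Fin N) (Fin N) ℂ => ∏ i, hMatZ (X * A) ((l i : ℤ) - (i : ℕ) + (σ i : ℕ)) := by
    ext X
    rw [schur, ← Matrix.det_transpose, Matrix.det_apply', Finset.sum_apply]
    rfl
  rw [hs]
  refine Submodule.sum_mem _ fun σ _ => W.smul_mem _ ?_
  by_cases hpos : ∀ i, 0 ≤ (l i : ℤ) - (i : ℕ) + (σ i : ℕ)
  · set ν : Fin N → ℕ := fun i => ((l i : ℤ) - (i : ℕ) + (σ i : ℕ)).toNat with hν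
    have hle : ∀ k, partSum l k ≤ partSum ν k := by
      intro k
      have h1 : ∀ i, l i + (σ i : ℕ) = ν i + i := by
        intro i
        have := hpos i
        simp only [hν]
        omega
      have h2 : partSum l k + partSum (fun i => (σ i : ℕ)) k =
          partSum ν k + partSum (fun i : Fin N => (i : ℕ)) k := by
        rw [← partSum_add, ← partSum_add]
        exact congrArg (partSum · k) (funext h1)
      have h3 := partSum_val_le_partSum_perm σ k
      omega
    have he : (fun X : Matrix (Fin N) (Fin N) ℂ =>
        ∏ i, hMatZ (X * A) ((l i : ℤ) - (i : ℕ) + (σ i : ℕ))) =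
        fun X => ∏ i, hMat (X * A) (ν i) := by
      ext X
      refine Finset.prod_congr rfl fun i _ => ?_
      rw [hMatZ, if_neg (not_lt.2 (hpos i))]
    rw [he]
    have hP : (fun X : Matrix (Fin N) (Fin N) ℂ => ∏ i, hMat (X * A) (ν i)) ∈
        homPoly N (∑ i, ν i) := prod_mem_homPoly Finset.univ fun i _ => hMat_mem_homPoly A (ν i)
    have hQ : (fun X : Matrix (Fin N) (Fin N) ℂ => schur m (X * B)) ∈ homPoly N (wt m) :=
      schur_mem_homPoly B m
    have hi := integrable_homPoly hN hP hQ
    have h0 := integral_prod_hMat_mul_schur_eq_zero hN A B m hm ν fun hcon =>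
      h fun k => (hle k).trans (hcon k)
    exact ⟨hi, h0⟩
  · push Not at hpos
    obtain ⟨i, hi⟩ := hpos
    have he : (fun X : Matrix (Fin N) (Fin N) ℂ =>
        ∏ i, hMatZ (X * A) ((l i : ℤ) - (i : ℕ) + (σ i : ℕ))) = 0 := by
      ext X
      exact Finset.prod_eq_zero (Finset.mem_univ i) (hMatZ_of_neg _ hi)
    rw [he]
    exact W.zero_mem

theorem hMat_congr_of_trace {M M' : Matrix (Fin N) (Fin N) ℂ}
    (h : ∀ m, (M ^ (m + 1)).trace = (M' ^ (m + 1)).trace) (k : ℕ) : hMat M k = hMat M' k := by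
  induction k using Nat.strong_induction_on with
  | _ n ih =>
    cases n with
    | zero => rw [hMat_zero, hMat_zero]
    | succ n =>
      rw [hMat, hMat]
      congr 1
      exact Finset.sum_congr rfl fun m _ => by rw [h, ih _ (by omega)]

theorem schur_mul_comm (l : Fin N → ℕ) (A B : Matrix (Fin N) (Fin N) ℂ) :
    schur l (A * B) = schur l (B * A) := by
  have h : ∀ m, ((A * B) ^ (m + 1)).trace = ((B * A) ^ (m + 1)).trace := by
    intro m
    have hs : SemiconjBy A (B * A) (A * B) := (Matrix.mul_assoc A B A).symm
    rw [pow_succ, ← Matrix.mul_assoc, ← (hs.pow_right m).eq, Matrix.mul_assoc,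
      Matrix.trace_mul_comm, Matrix.mul_assoc, ← pow_succ]
  simp_rw [schur, hMatZ, hMat_congr_of_trace h]

theorem hMat_conjTranspose (M : Matrix (Fin N) (Fin N) ℂ) (k : ℕ) :
    hMat Mᴴ k = starRingEnd ℂ (hMat M k) := by
  induction k using Nat.strong_induction_on with
  | _ n ih =>
    cases n with
    | zero => simp [hMat_zero]
    | succ n =>
      rw [hMat, hMat, map_mul, map_sum]
      congr 1
      · simp
      · refine Finset.sum_congr rfl fun m _ => ?_
        rw [ih _ (by omega), ← Matrix.conjTranspose_pow, Matrix.trace_conjTranspose, map_mul]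
        rfl

theorem schur_conjTranspose (l : Fin N → ℕ) (M : Matrix (Fin N) (Fin N) ℂ) :
    schur l Mᴴ = starRingEnd ℂ (schur l M) := by
  rw [schur, schur, RingHom.map_det]
  congr 1
  ext i j
  simp only [Matrix.of_apply, RingHom.mapMatrix_apply, Matrix.map_apply, hMatZ]
  split_ifs
  · simp
  · exact hMat_conjTranspose M _

theorem conj_integral_schur_mul_schur (A B : Matrix (Fin N) (Fin N) ℂ) (l m : Fin N → ℕ) :
    starRingEnd ℂ (∫ X, schur l (X * A) * schur m (Xᴴ * B) ∂(gaussianMatrix N)) =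
      ∫ X, schur m (X * Bᴴ) * schur l (Xᴴ * Aᴴ) ∂(gaussianMatrix N) := by
  rw [← integral_conj]
  refine integral_congr_ae (ae_of_all _ fun X => ?_)
  simp only [map_mul, ← schur_conjTranspose, Matrix.conjTranspose_mul,
    Matrix.conjTranspose_conjTranspose]
  rw [schur_mul_comm l, schur_mul_comm m, mul_comm]

theorem integral_schur_mul_schur_eq_zero (hN : 1 ≤ N) (A B : Matrix (Fin N) (Fin N) ℂ)
    (l m : Fin N → ℕ) (hl : Antitone l) (hm : Antitone m) (hlm : l ≠ m) :
    ∫ X, schur l (X * A) * schur m (Xᴴ * B) ∂(gaussianMatrix N) = 0 := by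
  by_cases h1 : ∀ k, partSum l k ≤ partSum m k
  · have h2 : ¬∀ k, partSum m k ≤ partSum l k := fun h2 =>
      hlm (eq_of_partSum_eq fun k _ => le_antisymm (h1 k) (h2 k))
    have h3 := conj_integral_schur_mul_schur A B l m
    rw [integral_schur_mul_schur_eq_zero_of_not_le hN _ _ m l hl h2] at h3
    exact (map_eq_zero _).1 h3
  · exact integral_schur_mul_schur_eq_zero_of_not_le hN A B l m hm h1

open scoped ComplexOrder in
theorem integral_schur_mul_schur_self (hN : 1 ≤ N) (A B : Matrix (Fin N) (Fin N) ℂ)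
    (l : Fin N → ℕ) (hl : Antitone l) :
    ∫ X, schur l (X * A) * schur l (Xᴴ * B) ∂(gaussianMatrix N) =
      (N : ℂ) ^ (-((wt l) : ℤ)) * (schur l (A * B) / schurPInf l) := by
  have h := integral_trace_pow_mul hN A (wt l) (schur_mem_homPoly B l)
  rw [if_pos rfl] at h
  have hmem : l ∈ partitionFinset N (wt l) := mem_partitionFinset.2 ⟨rfl, hl⟩
  have hX : ∀ X : Matrix (Fin N) (Fin N) ℂ, (X * A).trace ^ wt l * schur l (Xᴴ * B) =
      ∑ l' ∈ partitionFinset N (wt l), ((wt l).factorial * schurPInf l') *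
        (schur l' (X * A) * schur l (Xᴴ * B)) := by
    intro X
    rw [trace_pow_eq_sum_schur, Finset.mul_sum, Finset.sum_mul]
    exact Finset.sum_congr rfl fun l' _ => by ring
  simp_rw [hX] at h
  rw [integral_finsetSum _ fun l' _ => (integrable_schur_mul_schur hN A B l' l).const_mul _] at h
  simp_rw [integral_const_mul] at h
  rw [Finset.sum_eq_single_of_mem l hmem fun l' hl' hne => by
    rw [integral_schur_mul_schur_eq_zero hN A B l' l (mem_partitionFinset.1 hl').2 hl hne,
      mul_zero]] at h
  have hpos : schurPInf l ≠ 0 := (schurPInf_pos hl).ne'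
  have hfac : ((wt l).factorial : ℂ) ≠ 0 := Nat.cast_ne_zero.2 (wt l).factorial_ne_zero
  have hN' : (N : ℂ) ^ wt l ≠ 0 := pow_ne_zero _ (Nat.cast_ne_zero.2 (by omega))
  rw [_root_.zpow_neg, _root_.zpow_natCast]
  field_simp at h ⊢
  linear_combination h

end

/-- Gaussian analogue:
`∫ s_λ(XA) s_μ(X†B) dμ_G(X) = δ_{λ,μ} N^{-|λ|} s_λ(AB)/s_λ(p_∞)`. -/
theorem statement14 {N : ℕ} (hN : 1 ≤ N)
    (A B : Matrix (Fin N) (Fin N) ℂ)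
    (l m : Fin N → ℕ) (hl : Antitone l) (hm : Antitone m) :
    (∫ X : Matrix (Fin N) (Fin N) ℂ,
        schur l (X * A) * schur m (Xᴴ * B) ∂(gaussianMatrix N)) =
      if l = m then
        (N : ℂ) ^ (-((wt l) : ℤ)) * (schur l (A * B) / schurPInf l)
      else 0 := by
  split_ifs with h
  · subst h
    exact integral_schur_mul_schur_self hN A B l hl
  · exact integral_schur_mul_schur_eq_zero hN A B l m hl hm h

end
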